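/- arXiv:2412.11928 — 4 statements merged into one kernel-verified Lean document; each statement's English description precedes it below -/
import Mathlib

section
/- Let m, the curve data (γ, ν, κ, θ₀, θ), the tubular data (I, Φ, Ω) with Assumption 2, the operator U, and the transformed operator H^E_ε be as in the context, and let ε > 0. Then for every C^∞ function u : ℝ² → ℂ² with compact support contained in Ω and every (s,y) ∈ ℝ × I, one has (U(H_ε u))(s,y) = (H^E_ε (U u))(s,y); that is, the Dirac operator H_ε is conjugated by U into the normal form H^E_ε on the tubular neighborhood. -/
open MeasureTheory Complex

noncomputable section

abbrev C2 := Fin 2 → ℂ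

def pauli1 : Matrix (Fin 2) (Fin 2) ℂ := !![0, 1; 1, 0]
def pauli2 : Matrix (Fin 2) (Fin 2) ℂ := !![0, -Complex.I; Complex.I, 0]
def pauli3 : Matrix (Fin 2) (Fin 2) ℂ := !![1, 0; 0, -1]

def enorm2 (v : ℝ × ℝ) : ℝ := Real.sqrt (v.1 ^ 2 + v.2 ^ 2)
def perp2 (v : ℝ × ℝ) : ℝ × ℝ := (-v.2, v.1)
def dot2 (v w : ℝ × ℝ) : ℝ := v.1 * w.1 + v.2 * w.2
def grad2 (m : ℝ × ℝ → ℝ) (x : ℝ × ℝ) : ℝ × ℝ := (fderiv ℝ m x (1, 0), fderiv ℝ m x (0, 1))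

def pdx (u : ℝ × ℝ → C2) (x : ℝ × ℝ) : C2 := fderiv ℝ u x (1, 0)
def pdy (u : ℝ × ℝ → C2) (x : ℝ × ℝ) : C2 := fderiv ℝ u x (0, 1)

def diracOp (ε : ℝ) (m : ℝ × ℝ → ℝ) (u : ℝ × ℝ → C2) (x : ℝ × ℝ) : C2 :=
  (m x : ℂ) • pauli3.mulVec (u x)
    - (Complex.I * (ε : ℂ)) • pauli1.mulVec (pdx u x)
    - (Complex.I * (ε : ℂ)) • pauli2.mulVec (pdy u x)

structure IsClassicalSolution (ε : ℝ) (m : ℝ × ℝ → ℝ) (ψ : ℝ → ℝ × ℝ → C2) : Prop where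
  smooth : ContDiff ℝ (⊤ : ℕ∞) (fun p : ℝ × (ℝ × ℝ) => ψ p.1 p.2)
  schwartz : ∀ t : ℝ, ∀ k n : ℕ, ∃ C : ℝ, ∀ x : ℝ × ℝ,
      ‖x‖ ^ k * ‖iteratedFDeriv ℝ n (ψ t) x‖ ≤ C
  l2diff : ∃ F : ℝ → Lp C2 2 (volume : Measure (ℝ × ℝ)),
      Differentiable ℝ F ∧ ∀ t : ℝ, (F t : ℝ × ℝ → C2) =ᵐ[volume] ψ t
  eqn : ∀ t x, (Complex.I * (ε : ℂ)) • deriv (fun τ => ψ τ x) t = diracOp ε m (ψ t) x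

def nuVec (m : ℝ × ℝ → ℝ) (γ : ℝ → ℝ × ℝ) (s : ℝ) : ℝ × ℝ :=
  (enorm2 (grad2 m (γ s)))⁻¹ • grad2 m (γ s)

def curv (m : ℝ × ℝ → ℝ) (γ : ℝ → ℝ × ℝ) (s : ℝ) : ℝ :=
  dot2 (deriv (deriv γ) s) (nuVec m γ s)

def thetaFun (m : ℝ × ℝ → ℝ) (γ : ℝ → ℝ × ℝ) (θ₀ : ℝ) (s : ℝ) : ℝ :=
  θ₀ + ∫ η in (0:ℝ)..s, curv m γ η

def tubeMap (m : ℝ × ℝ → ℝ) (γ : ℝ → ℝ × ℝ) (p : ℝ × ℝ) : ℝ × ℝ :=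
  γ p.1 + p.2 • nuVec m γ p.1

structure CurveData (m : ℝ × ℝ → ℝ) (γ : ℝ → ℝ × ℝ) : Prop where
  smooth : ContDiff ℝ (⊤ : ℕ∞) γ
  grad_ne : ∀ s, grad2 m (γ s) ≠ 0
  ode : ∀ s, deriv γ s = (enorm2 (grad2 m (γ s)))⁻¹ • (-(perp2 (grad2 m (γ s))))
  start : m (γ 0) = 0

structure TubularData (m : ℝ × ℝ → ℝ) (γ : ℝ → ℝ × ℝ) (K : ℝ) : Prop where
  Ksup : K = sSup (Set.range fun s => |curv m γ s|)
  Kpos : 0 < K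
  Kbdd : BddAbove (Set.range fun s => |curv m γ s|)
  inj : Set.InjOn (tubeMap m γ) (Set.univ ×ˢ Set.Ioo (-(1/(2*K))) (1/(2*K)))
  inv : ∃ Ψ : ℝ × ℝ → ℝ × ℝ,
      ContDiffOn ℝ (⊤ : ℕ∞) Ψ (tubeMap m γ '' (Set.univ ×ˢ Set.Ioo (-(1/(2*K))) (1/(2*K)))) ∧
      ∀ p ∈ Set.univ ×ˢ Set.Ioo (-(1/(2*K))) (1/(2*K)), Ψ (tubeMap m γ p) = p

def uMat (θv : ℝ) : Matrix (Fin 2) (Fin 2) ℂ :=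
  !![Complex.exp (Complex.I * ((Real.pi/4 + θv/2 : ℝ) : ℂ)),
     -Complex.exp (-(Complex.I * ((Real.pi/4 + θv/2 : ℝ) : ℂ)));
     Complex.exp (Complex.I * ((Real.pi/4 + θv/2 : ℝ) : ℂ)),
     Complex.exp (-(Complex.I * ((Real.pi/4 + θv/2 : ℝ) : ℂ)))]

def uOp (m : ℝ × ℝ → ℝ) (γ : ℝ → ℝ × ℝ) (θ₀ : ℝ) (u : ℝ × ℝ → C2) (p : ℝ × ℝ) : C2 :=
  ((Real.sqrt ((1 - p.2 * curv m γ p.1)/2) : ℝ) : ℂ) •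
    (uMat (thetaFun m γ θ₀ p.1)).mulVec (u (tubeMap m γ p))

def transOp (ε : ℝ) (m : ℝ × ℝ → ℝ) (γ : ℝ → ℝ × ℝ) (v : ℝ × ℝ → C2) (p : ℝ × ℝ) : C2 :=
  (m (tubeMap m γ p) : ℂ) • pauli1.mulVec (v p)
  + (Complex.I * (ε : ℂ)) • pauli2.mulVec (pdy v p)
  - (Complex.I * (ε : ℂ) / ((1 - p.2 * curv m γ p.1 : ℝ) : ℂ)) • pauli3.mulVec (pdx v p)
  - (Complex.I * (ε : ℂ) * (p.2 : ℂ) * ((deriv (curv m γ) p.1 : ℝ) : ℂ)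
      / ((2 * (1 - p.2 * curv m γ p.1)^2 : ℝ) : ℂ)) • pauli3.mulVec (v p)

lemma aux_unit {m : ℝ × ℝ → ℝ} {γ : ℝ → ℝ × ℝ} (h : CurveData m γ) (s : ℝ) :
    (nuVec m γ s).1 ^ 2 + (nuVec m γ s).2 ^ 2 = 1 := by
  have hne := h.grad_ne s
  set g := grad2 m (γ s) with hg
  have hpos : 0 < g.1 ^ 2 + g.2 ^ 2 := by
    rcases lt_or_eq_of_le (by positivity : 0 ≤ g.1 ^ 2 + g.2 ^ 2) with h1 | h1
    · exact h1
    · exfalso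
      apply hne
      have h2 : g.1 = 0 := by nlinarith [sq_nonneg g.1, sq_nonneg g.2]
      have h3 : g.2 = 0 := by nlinarith [sq_nonneg g.1, sq_nonneg g.2]
      exact Prod.ext h2 h3
  have hs : enorm2 g ^ 2 = g.1 ^ 2 + g.2 ^ 2 := Real.sq_sqrt hpos.le
  have hsne : enorm2 g ≠ 0 := (Real.sqrt_pos.2 hpos).ne'
  simp only [nuVec, ← hg, Prod.smul_fst, Prod.smul_snd, smul_eq_mul]
  field_simp
  linarith

lemma aux_dγ {m : ℝ × ℝ → ℝ} {γ : ℝ → ℝ × ℝ} (h : CurveData m γ) (s : ℝ) :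
    deriv γ s = ((nuVec m γ s).2, -(nuVec m γ s).1) := by
  rw [h.ode]
  simp [nuVec, perp2]

lemma aux_nu {m : ℝ × ℝ → ℝ} {γ : ℝ → ℝ × ℝ} (h : CurveData m γ) :
    nuVec m γ = fun s => (-(deriv γ s).2, (deriv γ s).1) := by
  funext s
  rw [aux_dγ h]; simp

lemma aux_smooth_d {m : ℝ × ℝ → ℝ} {γ : ℝ → ℝ × ℝ} (h : CurveData m γ) :
    ContDiff ℝ (⊤ : ℕ∞) (deriv γ) := (contDiff_infty_iff_deriv.1 h.smooth).2

lemma aux_smooth_nu {m : ℝ × ℝ → ℝ} {γ : ℝ → ℝ × ℝ} (h : CurveData m γ) :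
    ContDiff ℝ (⊤ : ℕ∞) (nuVec m γ) := by
  rw [aux_nu h]
  have := aux_smooth_d h
  fun_prop

lemma aux_smooth_curv {m : ℝ × ℝ → ℝ} {γ : ℝ → ℝ × ℝ} (h : CurveData m γ) :
    ContDiff ℝ (⊤ : ℕ∞) (curv m γ) := by
  have h1 := aux_smooth_nu h
  have h2 : ContDiff ℝ (⊤ : ℕ∞) (deriv (deriv γ)) :=
    (contDiff_infty_iff_deriv.1 (aux_smooth_d h)).2
  exact (h2.fst.mul h1.fst).add (h2.snd.mul h1.snd)

lemma aux_dnu {m : ℝ × ℝ → ℝ} {γ : ℝ → ℝ × ℝ} (h : CurveData m γ) (s : ℝ) :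
    HasDerivAt (fun t => (nuVec m γ t).1) (-(curv m γ s) * (nuVec m γ s).2) s ∧
    HasDerivAt (fun t => (nuVec m γ t).2) (curv m γ s * (nuVec m γ s).1) s := by
  have hd : HasDerivAt (deriv γ) (deriv (deriv γ) s) s :=
    ((aux_smooth_d h).differentiable (by simp) s).hasDerivAt
  have hd1 : HasDerivAt (fun t => (deriv γ t).1) (deriv (deriv γ) s).1 s := (hasFDerivAt_fst (p := deriv γ s)).comp_hasDerivAt s hd
  have hd2 : HasDerivAt (fun t => (deriv γ t).2) (deriv (deriv γ) s).2 s := (hasFDerivAt_snd (p := deriv γ s)).comp_hasDerivAt s hd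
  have hu : ∀ t, (deriv γ t).1 ^ 2 + (deriv γ t).2 ^ 2 = 1 := by
    intro t
    have := aux_unit h t
    rw [aux_dγ h]
    simp only
    linarith
  have hk : curv m γ s = -(deriv (deriv γ) s).1 * (deriv γ s).2
      + (deriv (deriv γ) s).2 * (deriv γ s).1 := by
    rw [curv, dot2, aux_nu h]; simp
  have h0 : 2 * (deriv γ s).1 * (deriv (deriv γ) s).1
      + 2 * (deriv γ s).2 * (deriv (deriv γ) s).2 = 0 := by
    have h1 := (hd1.pow 2).add (hd2.pow 2)
    have h2 : ((fun t => (deriv γ t).1) ^ 2 + (fun t => (deriv γ t).2) ^ 2) = fun _ => (1:ℝ) := by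
      funext t; simpa using hu t
    rw [h2] at h1
    have h3 := h1.unique (hasDerivAt_const s (1:ℝ))
    simp at h3
    linarith
  have hus := hu s
  rw [hk, aux_nu h]
  constructor
  · refine hd2.neg.congr_deriv ?_
    simp only
    linear_combination (-(deriv γ s).2/2) * h0 + (deriv (deriv γ) s).2 * hus
  · refine hd1.congr_deriv ?_
    simp only
    linear_combination ((deriv γ s).1/2) * h0 - (deriv (deriv γ) s).1 * hus

lemma aux_dtheta {m : ℝ × ℝ → ℝ} {γ : ℝ → ℝ × ℝ} (h : CurveData m γ) (θ₀ s : ℝ) :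
    HasDerivAt (thetaFun m γ θ₀) (curv m γ s) s := by
  have hc : Continuous (curv m γ) := (aux_smooth_curv h).continuous
  exact (intervalIntegral.integral_hasDerivAt_right (hc.intervalIntegrable _ _)
    (hc.stronglyMeasurableAtFilter _ _) hc.continuousAt).const_add θ₀

lemma aux_angle {m : ℝ × ℝ → ℝ} {γ : ℝ → ℝ × ℝ} (h : CurveData m γ) (θ₀ : ℝ)
    (h0 : nuVec m γ 0 = (Real.cos θ₀, Real.sin θ₀)) (s : ℝ) :
    (nuVec m γ s).1 = Real.cos (thetaFun m γ θ₀ s) ∧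
    (nuVec m γ s).2 = Real.sin (thetaFun m γ θ₀ s) := by
  have hth0 : thetaFun m γ θ₀ 0 = θ₀ := by simp [thetaFun]
  set θ := thetaFun m γ θ₀ with hθ
  have key : ∀ t, HasDerivAt (fun t => (nuVec m γ t).1 * Real.cos (θ t)
      + (nuVec m γ t).2 * Real.sin (θ t)) 0 t := by
    intro t
    have hd := aux_dtheta h θ₀ t
    refine (((aux_dnu h t).1.mul hd.cos).add ((aux_dnu h t).2.mul hd.sin)).congr_deriv ?_
    ring
  have key2 : ∀ t, HasDerivAt (fun t => (nuVec m γ t).2 * Real.cos (θ t)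
      - (nuVec m γ t).1 * Real.sin (θ t)) 0 t := by
    intro t
    have hd := aux_dtheta h θ₀ t
    refine (((aux_dnu h t).2.mul hd.cos).sub ((aux_dnu h t).1.mul hd.sin)).congr_deriv ?_
    ring
  have e1 := is_const_of_deriv_eq_zero (fun t => (key t).differentiableAt)
    (fun t => (key t).deriv) s 0
  have e2 := is_const_of_deriv_eq_zero (fun t => (key2 t).differentiableAt)
    (fun t => (key2 t).deriv) s 0
  simp only [h0, hth0] at e1 e2
  have c0 := Real.cos_sq_add_sin_sq θ₀
  have c1 := Real.cos_sq_add_sin_sq (θ s)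
  constructor
  · linear_combination Real.cos (θ s) * e1 - Real.sin (θ s) * e2
      - (nuVec m γ s).1 * c1 + Real.cos (θ s) * c0
  · linear_combination Real.sin (θ s) * e1 + Real.cos (θ s) * e2
      - (nuVec m γ s).2 * c1 + Real.sin (θ s) * c0

lemma aux_pos {m : ℝ × ℝ → ℝ} {γ : ℝ → ℝ × ℝ} {K : ℝ} (ht : TubularData m γ K) (s y : ℝ)
    (hy : y ∈ Set.Ioo (-(1/(2*K))) (1/(2*K))) : 0 < 1 - y * curv m γ s := by
  have hK := ht.Kpos
  have h1 : |curv m γ s| ≤ K := by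
    rw [ht.Ksup]; exact le_csSup ht.Kbdd ⟨s, rfl⟩
  have h2 : |y| < 1/(2*K) := abs_lt.2 hy
  have h3 : |y * curv m γ s| ≤ 1/2 := by
    rw [abs_mul]
    calc |y| * |curv m γ s| ≤ 1/(2*K) * K := by gcongr
      _ = 1/2 := by field_simp
  linarith [(abs_le.1 h3).2]

/-- The phase factor. -/
def aPh (t : ℝ) : ℂ := Complex.exp (Complex.I * ((Real.pi/4 + t/2 : ℝ) : ℂ))
/-- The conjugate phase factor. -/
def bPh (t : ℝ) : ℂ := Complex.exp (-(Complex.I * ((Real.pi/4 + t/2 : ℝ) : ℂ)))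

lemma aPh_deriv (t : ℝ) : HasDerivAt aPh (Complex.I / 2 * aPh t) t := by
  have h1 : HasDerivAt (fun t : ℝ => (Real.pi/4 + t/2 : ℝ)) (1/2) t :=
    ((hasDerivAt_id t).div_const 2).const_add _
  have h2 := (h1.ofReal_comp.const_mul Complex.I).cexp
  refine h2.congr_deriv ?_
  simp only [aPh]; push_cast; ring

lemma bPh_deriv (t : ℝ) : HasDerivAt bPh (-Complex.I / 2 * bPh t) t := by
  have h1 : HasDerivAt (fun t : ℝ => (Real.pi/4 + t/2 : ℝ)) (1/2) t :=
    ((hasDerivAt_id t).div_const 2).const_add _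
  have h2 := (h1.ofReal_comp.const_mul Complex.I).neg.cexp
  refine h2.congr_deriv ?_
  simp only [bPh, Pi.neg_apply]; push_cast; ring

lemma aPh_mul_bPh (t : ℝ) : aPh t * bPh t = 1 := by
  simp [aPh, bPh, ← Complex.exp_add]

lemma exp_pi4 : Complex.exp (Complex.I * (Real.pi / 2 : ℝ)) = Complex.I := by
  rw [mul_comm]; push_cast; exact Complex.exp_pi_div_two_mul_I

lemma aPh_sq (t : ℝ) : aPh t * aPh t
    = Complex.I * ((Real.cos t : ℂ) + Complex.I * (Real.sin t : ℂ)) := by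
  have : aPh t * aPh t = Complex.exp (Complex.I * (Real.pi / 2 : ℝ)) *
      Complex.exp ((t : ℂ) * Complex.I) := by
    simp only [aPh, ← Complex.exp_add]; congr 1; push_cast; ring
  rw [this, exp_pi4, Complex.exp_mul_I]; push_cast; ring

lemma aux_fderiv (u : ℝ × ℝ → C2) (x : ℝ × ℝ) (a b : ℝ) :
    fderiv ℝ u x (a, b) = (a : ℂ) • pdx u x + (b : ℂ) • pdy u x := by
  have : ((a, b) : ℝ × ℝ) = a • ((1, 0) : ℝ × ℝ) + b • ((0, 1) : ℝ × ℝ) := by simp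
  rw [this, map_add, map_smul, map_smul]
  rfl

lemma uOp_eq (m : ℝ × ℝ → ℝ) (γ : ℝ → ℝ × ℝ) (θ₀ : ℝ) (u : ℝ × ℝ → C2) :
    uOp m γ θ₀ u = fun p => ![
      ((Real.sqrt ((1 - p.2 * curv m γ p.1)/2) : ℝ) : ℂ) *
        (aPh (thetaFun m γ θ₀ p.1) * u (tubeMap m γ p) 0
          - bPh (thetaFun m γ θ₀ p.1) * u (tubeMap m γ p) 1),
      ((Real.sqrt ((1 - p.2 * curv m γ p.1)/2) : ℝ) : ℂ) *
        (aPh (thetaFun m γ θ₀ p.1) * u (tubeMap m γ p) 0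
          + bPh (thetaFun m γ θ₀ p.1) * u (tubeMap m γ p) 1)] := by
  funext p i
  fin_cases i
  · simp [uOp, uMat, aPh, bPh, dotProduct, Fin.sum_univ_two, sub_eq_add_neg]
  · simp [uOp, uMat, aPh, bPh, dotProduct, Fin.sum_univ_two]

lemma aPh_rel (t : ℝ) : aPh t * ((Real.cos t : ℂ) - Complex.I * (Real.sin t : ℂ))
    = Complex.I * bPh t := by
  have h1 := aPh_mul_bPh t
  have h2 := aPh_sq t
  have h3 : (Real.cos t : ℂ) ^ 2 + (Real.sin t : ℂ) ^ 2 = 1 := by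
    exact_mod_cast Real.cos_sq_add_sin_sq t
  have h4 := Complex.I_mul_I
  have h5 : aPh t ≠ 0 := left_ne_zero_of_mul_eq_one h1
  apply mul_left_cancel₀ h5
  grind

lemma bPh_rel (t : ℝ) : bPh t * ((Real.cos t : ℂ) + Complex.I * (Real.sin t : ℂ))
    = -Complex.I * aPh t := by
  have h1 := aPh_mul_bPh t
  have h2 := aPh_sq t
  have h4 := Complex.I_mul_I
  have h5 : aPh t ≠ 0 := left_ne_zero_of_mul_eq_one h1
  apply mul_left_cancel₀ h5
  grind

lemma aux_alg (M ε R Q q κ k y a b c S J u0 u1 p0 p1 r0 r1 : ℂ) (hJ : J * J = -1)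
    (hq : q * Q = 1) (h1 : a * (c - J * S) = J * b) (h2 : b * (c + J * S) = -J * a) :
    R * (a * (M * u0 - J * ε * p1 - J * ε * (-J * r1))
      - b * (-(M * u1) - J * ε * p0 - J * ε * (J * r0)))
    = M * (R * (a * u0 + b * u1))
      + J * ε * (-J * (-(κ * R * Q / 2) * (a * u0 + b * u1)
          + R * (a * (c * p0 + S * r0) + b * (c * p1 + S * r1))))
      - J * ε * Q * (-(y * k * R * Q / 2) * (a * u0 - b * u1)
          + R * ((κ * (J / 2 * a) * u0 + a * (q * S * p0 - q * c * r0))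
              - (κ * (-J / 2 * b) * u1 + b * (q * S * p1 - q * c * r1))))
      - J * ε * y * k * (Q ^ 2 / 2) * (R * (a * u0 - b * u1)) := by
  linear_combination (-ε * R * (p0 + J * r0)) * h1 + (-ε * R * (p1 - J * r1)) * h2
    + (J * ε * R * (a * (S * p0 - c * r0) - b * (S * p1 - c * r1))) * hq
    + (R * ε * c * (a * p0 + b * p1)) * hJ

lemma aux_alg' (M ε R Q q κ k y a b c S J u0 u1 p0 p1 r0 r1 : ℂ) (hJ : J * J = -1)
    (hq : q * Q = 1) (h1 : a * (c - J * S) = J * b) (h2 : b * (c + J * S) = -J * a) :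
    R * (a * (M * u0 - J * ε * p1 - J * ε * (-J * r1))
      + b * (-(M * u1) - J * ε * p0 - J * ε * (J * r0)))
    = M * (R * (a * u0 - b * u1))
      + J * ε * (J * (-(κ * R * Q / 2) * (a * u0 - b * u1)
          + R * (a * (c * p0 + S * r0) - b * (c * p1 + S * r1))))
      + J * ε * Q * (-(y * k * R * Q / 2) * (a * u0 + b * u1)
          + R * ((κ * (J / 2 * a) * u0 + a * (q * S * p0 - q * c * r0))
              + (κ * (-J / 2 * b) * u1 + b * (q * S * p1 - q * c * r1))))
      + J * ε * y * k * (Q ^ 2 / 2) * (R * (a * u0 + b * u1)) := by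
  linear_combination (ε * R * (p0 + J * r0)) * h1 + (-ε * R * (p1 - J * r1)) * h2
    + (-J * ε * R * (a * (S * p0 - c * r0) + b * (S * p1 - c * r1))) * hq
    + (R * ε * c * (b * p1 - a * p0)) * hJ

lemma aux_sqrt (k R q : ℝ) (hR : 0 < R) (h : R ^ 2 = q / 2) :
    -k / 2 / (2 * R) = -(k * R * q⁻¹ / 2) := by
  have : q = 2 * R ^ 2 := by linarith
  subst this
  field_simp

lemma transOp_zero (ε : ℝ) (m : ℝ × ℝ → ℝ) (γ : ℝ → ℝ × ℝ) (v : ℝ × ℝ → C2) (s y : ℝ) : transOp ε m γ v (s, y) 0 =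
    (m (tubeMap m γ (s, y)) : ℂ) * v (s, y) 1
    + Complex.I * ε * (-Complex.I * fderiv ℝ (v) (s, y) (0, 1) 1)
    - Complex.I * ε * (((1 - y * curv m γ s)⁻¹ : ℝ) : ℂ)
      * fderiv ℝ (v) (s, y) (1, 0) 0
    - Complex.I * ε * y * (deriv (curv m γ) s : ℝ)
      * ((((1 - y * curv m γ s)⁻¹ : ℝ) : ℂ) ^ 2 / 2) * v (s, y) 0 := by
  simp [transOp, pdx, pdy, pauli1, pauli2, pauli3, dotProduct, Fin.sum_univ_two]
  generalize (1 - (y : ℂ) * (curv m γ s : ℂ)) = q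
  ring

lemma transOp_one (ε : ℝ) (m : ℝ × ℝ → ℝ) (γ : ℝ → ℝ × ℝ) (v : ℝ × ℝ → C2) (s y : ℝ) : transOp ε m γ v (s, y) 1 =
    (m (tubeMap m γ (s, y)) : ℂ) * v (s, y) 0
    + Complex.I * ε * (Complex.I * fderiv ℝ (v) (s, y) (0, 1) 0)
    + Complex.I * ε * (((1 - y * curv m γ s)⁻¹ : ℝ) : ℂ)
      * fderiv ℝ (v) (s, y) (1, 0) 1
    + Complex.I * ε * y * (deriv (curv m γ) s : ℝ)
      * ((((1 - y * curv m γ s)⁻¹ : ℝ) : ℂ) ^ 2 / 2) * v (s, y) 1 := by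
  simp [transOp, pdx, pdy, pauli1, pauli2, pauli3, dotProduct, Fin.sum_univ_two]
  generalize (1 - (y : ℂ) * (curv m γ s : ℂ)) = q
  ring

lemma diracOp_zero (ε : ℝ) (m : ℝ × ℝ → ℝ) (u : ℝ × ℝ → C2) : ∀ x, diracOp ε m u x 0 = (m x : ℂ) * u x 0 - Complex.I * ε * pdx u x 1
    - Complex.I * ε * (-Complex.I * pdy u x 1) := by
  intro x
  simp [diracOp, pauli1, pauli2, pauli3, dotProduct, Fin.sum_univ_two]

lemma diracOp_one (ε : ℝ) (m : ℝ × ℝ → ℝ) (u : ℝ × ℝ → C2) : ∀ x, diracOp ε m u x 1 = -((m x : ℂ) * u x 1) - Complex.I * ε * pdx u x 0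
    - Complex.I * ε * (Complex.I * pdy u x 0) := by
  intro x
  simp [diracOp, pauli1, pauli2, pauli3, dotProduct, Fin.sum_univ_two]

/-- The Dirac operator `H_ε` is conjugated by `U` into the normal form
`H^E_ε` on the tubular neighborhood. -/
theorem stmt1
    (m : ℝ × ℝ → ℝ) (hm : ContDiff ℝ (⊤ : ℕ∞) m)
    (γ : ℝ → ℝ × ℝ) (hcurve : CurveData m γ)
    (θ₀ : ℝ) (hθ₀ : θ₀ ∈ Set.Ico 0 (2 * Real.pi))
    (hν₀ : nuVec m γ 0 = (Real.cos θ₀, Real.sin θ₀))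
    (K : ℝ) (htube : TubularData m γ K)
    (ε : ℝ) (hε : 0 < ε)
    (u : ℝ × ℝ → C2) (hu : ContDiff ℝ (⊤ : ℕ∞) u) (husupp : HasCompactSupport u)
    (hΩ : tsupport u ⊆ tubeMap m γ '' (Set.univ ×ˢ Set.Ioo (-(1/(2*K))) (1/(2*K))))
    (s y : ℝ) (hy : y ∈ Set.Ioo (-(1/(2*K))) (1/(2*K))) :
    uOp m γ θ₀ (diracOp ε m u) (s, y) = transOp ε m γ (uOp m γ θ₀ u) (s, y) := by
  have hpos := aux_pos htube s y hy
  have hν1 := (aux_angle hcurve θ₀ hν₀ s).1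
  have hν2 := (aux_angle hcurve θ₀ hν₀ s).2
  have hcd : Differentiable ℝ (curv m γ) := (aux_smooth_curv hcurve).differentiable (by simp)
  have hνd : Differentiable ℝ (nuVec m γ) := (aux_smooth_nu hcurve).differentiable (by simp)
  have hγd : Differentiable ℝ γ := hcurve.smooth.differentiable (by simp)
  have hud : Differentiable ℝ u := hu.differentiable (by simp)
  have hθd : Differentiable ℝ (thetaFun m γ θ₀) :=
    fun t => (aux_dtheta hcurve θ₀ t).differentiableAt
  have had : Differentiable ℝ aPh := fun t => (aPh_deriv t).differentiableAt
  have hbd : Differentiable ℝ bPh := fun t => (bPh_deriv t).differentiableAt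
  have hΦd : Differentiable ℝ (tubeMap m γ) := by
    unfold tubeMap; fun_prop
  have hui : ∀ i, Differentiable ℝ (fun p => u (tubeMap m γ p) i) := by
    intro i; exact differentiable_pi.1 (hud.comp hΦd) i
  have hrd : DifferentiableAt ℝ
      (fun p : ℝ × ℝ => ((Real.sqrt ((1 - p.2 * curv m γ p.1)/2) : ℝ) : ℂ)) (s, y) := by
    apply Complex.ofRealCLM.differentiableAt.comp (s, y)
    apply DifferentiableAt.sqrt
    · fun_prop
    · simp only; positivity
  have hvd : DifferentiableAt ℝ (uOp m γ θ₀ u) (s, y) := by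
    rw [uOp_eq]
    have h0 := hui 0
    have h1 := hui 1
    rw [differentiableAt_pi]
    intro i
    fin_cases i
    · simp only [Fin.zero_eta, Matrix.cons_val_zero]
      fun_prop
    · simp only [Fin.mk_one, Matrix.cons_val_one, Matrix.cons_val_zero]
      fun_prop
  have hls : HasDerivAt (fun t : ℝ => ((t, y) : ℝ × ℝ)) (1, 0) s :=
    (hasDerivAt_id s).prodMk (hasDerivAt_const s y)
  have hly : HasDerivAt (fun t : ℝ => ((s, t) : ℝ × ℝ)) (0, 1) y :=
    (hasDerivAt_const y s).prodMk (hasDerivAt_id y)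
  have hpx := hasDerivAt_pi.1 (hvd.hasFDerivAt.comp_hasDerivAt s hls)
  have hpy := hasDerivAt_pi.1 (hvd.hasFDerivAt.comp_hasDerivAt y hly)
  -- derivative of the tube map
  have hγ' : HasDerivAt γ ((nuVec m γ s).2, -(nuVec m γ s).1) s := by
    rw [← aux_dγ hcurve]; exact (hγd s).hasDerivAt
  have hν' : HasDerivAt (nuVec m γ)
      (-(curv m γ s) * (nuVec m γ s).2, curv m γ s * (nuVec m γ s).1) s :=
    (aux_dnu hcurve s).1.prodMk (aux_dnu hcurve s).2
  have hΦs : HasDerivAt (fun t => tubeMap m γ (t, y))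
      ((1 - y * curv m γ s) * (nuVec m γ s).2, -((1 - y * curv m γ s) * (nuVec m γ s).1)) s := by
    refine (hγ'.add (hν'.const_smul y)).congr_deriv ?_
    ext <;> simp <;> ring
  have hΦy : HasDerivAt (fun t => tubeMap m γ (s, t))
      ((nuVec m γ s).1, (nuVec m γ s).2) y := by
    refine (((hasDerivAt_id y).smul_const (nuVec m γ s)).const_add (γ s)).congr_deriv ?_
    simp
  have hus := hasDerivAt_pi.1 ((hud (tubeMap m γ (s, y))).hasFDerivAt.comp_hasDerivAt s hΦs)
  have huy := hasDerivAt_pi.1 ((hud (tubeMap m γ (s, y))).hasFDerivAt.comp_hasDerivAt y hΦy)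
  simp only [aux_fderiv] at hus huy
  have hr0 : (1 - y * curv m γ s)/2 ≠ 0 := by positivity
  have hRR : Real.sqrt ((1 - y * curv m γ s)/2) ^ 2 = (1 - y * curv m γ s)/2 :=
    Real.sq_sqrt (by positivity)
  have hRpos : 0 < Real.sqrt ((1 - y * curv m γ s)/2) := Real.sqrt_pos.2 (by positivity)
  have hrs : HasDerivAt (fun t => ((Real.sqrt ((1 - y * curv m γ t)/2) : ℝ) : ℂ))
      ((-(y * deriv (curv m γ) s * Real.sqrt ((1 - y * curv m γ s)/2)
        * (1 - y * curv m γ s)⁻¹ / 2) : ℝ) : ℂ) s := by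
    refine HasDerivAt.ofReal_comp (HasDerivAt.congr_deriv
      ((((hcd s).hasDerivAt.const_mul y).const_sub 1 |>.div_const 2).sqrt hr0) ?_)
    exact aux_sqrt _ _ _ hRpos hRR
  have hry : HasDerivAt (fun t => ((Real.sqrt ((1 - t * curv m γ s)/2) : ℝ) : ℂ))
      ((-(curv m γ s * Real.sqrt ((1 - y * curv m γ s)/2)
        * (1 - y * curv m γ s)⁻¹ / 2) : ℝ) : ℂ) y := by
    refine HasDerivAt.ofReal_comp (HasDerivAt.congr_deriv
      ((((hasDerivAt_id y).mul_const (curv m γ s)).const_sub 1 |>.div_const 2).sqrt hr0) ?_)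
    rw [one_mul]
    exact aux_sqrt _ _ _ hRpos hRR
  have has := (aPh_deriv (thetaFun m γ θ₀ s)).scomp s (aux_dtheta hcurve θ₀ s)
  have hbs := (bPh_deriv (thetaFun m γ θ₀ s)).scomp s (aux_dtheta hcurve θ₀ s)
  have x0 := hrs.mul ((has.mul (hus 0)).sub (hbs.mul (hus 1)))
  have x1 := hrs.mul ((has.mul (hus 0)).add (hbs.mul (hus 1)))
  have y0 := hry.mul (((huy 0).const_mul (aPh (thetaFun m γ θ₀ s))).sub
    ((huy 1).const_mul (bPh (thetaFun m γ θ₀ s))))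
  have y1 := hry.mul (((huy 0).const_mul (aPh (thetaFun m γ θ₀ s))).add
    ((huy 1).const_mul (bPh (thetaFun m γ θ₀ s))))
  have X0 := (hpx 0).unique (x0.congr_of_eventuallyEq (Filter.Eventually.of_forall fun t => by
    simp [uOp_eq]))
  have X1 := (hpx 1).unique (x1.congr_of_eventuallyEq (Filter.Eventually.of_forall fun t => by
    simp [uOp_eq]))
  have Y0 := (hpy 0).unique (y0.congr_of_eventuallyEq (Filter.Eventually.of_forall fun t => by
    simp [uOp_eq]))
  have Y1 := (hpy 1).unique (y1.congr_of_eventuallyEq (Filter.Eventually.of_forall fun t => by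
    simp [uOp_eq]))
  clear hpx hpy x0 x1 y0 y1
  have hqQ : ((1 - y * curv m γ s : ℝ) : ℂ) * (((1 - y * curv m γ s)⁻¹ : ℝ) : ℂ) = 1 := by
    rw [← Complex.ofReal_mul, mul_inv_cancel₀ hpos.ne', Complex.ofReal_one]
  have r1 := aPh_rel (thetaFun m γ θ₀ s)
  have r2 := bPh_rel (thetaFun m γ θ₀ s)
  simp only [hν1, hν2] at X0 X1 Y0 Y1
  have A0 := fun k u0 u1 p0 p1 r0 r1' => aux_alg (m (tubeMap m γ (s, y)) : ℂ) (ε : ℂ)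
    ((Real.sqrt ((1 - y * curv m γ s)/2) : ℝ) : ℂ) _ _ (curv m γ s : ℂ) k (y : ℂ) _ _ _ _ _
    u0 u1 p0 p1 r0 r1' Complex.I_mul_I hqQ r1 r2
  have A1 := fun k u0 u1 p0 p1 r0 r1' => aux_alg' (m (tubeMap m γ (s, y)) : ℂ) (ε : ℂ)
    ((Real.sqrt ((1 - y * curv m γ s)/2) : ℝ) : ℂ) _ _ (curv m γ s : ℂ) k (y : ℂ) _ _ _ _ _
    u0 u1 p0 p1 r0 r1' Complex.I_mul_I hqQ r1 r2
  specialize A0 (deriv (curv m γ) s : ℝ) (u (tubeMap m γ (s, y)) 0) (u (tubeMap m γ (s, y)) 1)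
    (pdx u (tubeMap m γ (s, y)) 0) (pdx u (tubeMap m γ (s, y)) 1)
    (pdy u (tubeMap m γ (s, y)) 0) (pdy u (tubeMap m γ (s, y)) 1)
  specialize A1 (deriv (curv m γ) s : ℝ) (u (tubeMap m γ (s, y)) 0) (u (tubeMap m γ (s, y)) 1)
    (pdx u (tubeMap m γ (s, y)) 0) (pdx u (tubeMap m γ (s, y)) 1)
    (pdy u (tubeMap m γ (s, y)) 0) (pdy u (tubeMap m γ (s, y)) 1)
  have E0 := transOp_zero ε m γ (uOp m γ θ₀ u) s y
  have E1 := transOp_one ε m γ (uOp m γ θ₀ u) s y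
  have D0 := diracOp_zero ε m u
  have D1 := diracOp_one ε m u
  funext i
  fin_cases i
  · simp only [Fin.zero_eta]
    rw [E0, X0, Y1]
    simp only [uOp_eq, Matrix.cons_val_zero, Matrix.cons_val_one, D0, D1]
    rw [A0]
    simp only [Pi.add_apply, Pi.sub_apply, Pi.mul_apply, Pi.smul_apply, Function.comp_apply,
      smul_eq_mul, Complex.real_smul]
    push_cast
    ring
  · simp only [Fin.mk_one]
    rw [E1, X1, Y0]
    simp only [uOp_eq, Matrix.cons_val_zero, Matrix.cons_val_one, D0, D1]
    rw [A1]
    simp only [Pi.add_apply, Pi.sub_apply, Pi.mul_apply, Pi.smul_apply, Function.comp_apply,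
      smul_eq_mul, Complex.real_smul]
    push_cast
    ring
end
end

section
/- Let m, the curve data (γ, ν, κ), the tubular data (Φ) and the transformed operator H^E_ε be as in the context, let ε ∈ (0,1], let δ ∈ (0, 1/(4‖κ‖_∞)], and set I_{1/2} := (−1/(4‖κ‖_∞), 1/(4‖κ‖_∞)). Let φ : ℝ × ℝ × I_{1/2} → ℂ² be C^∞ and satisfy iε ∂_t φ(t,s,y) = (H^E_ε φ(t,·,·))(s,y) on ℝ × ℝ × I_{1/2}. Define u(t,s,y) := ε^{1/4} φ(t,s,√ε y). Then for all t ∈ ℝ, s ∈ ℝ and y with |y| < δ/√ε: i√ε ∂_t u(t,s,y) = y|∇m(γ(s))| σ₁ u(t,s,y) + i σ₂ ∂_y u(t,s,y) − (i√ε/(1 − √ε y κ(s))) σ₃ ∂_s u(t,s,y) − (iε y κ'(s)/(2(1 − √ε y κ(s))²)) σ₃ u(t,s,y) + √ε y² (∫₀¹ (1−τ) ⟨∇²m(Φ(s,τ√ε y)) ν(s), ν(s)⟩ dτ) σ₁ u(t,s,y), where ∇²m denotes the Hessian of m. -/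
open MeasureTheory Complex

noncomputable section

/-- Hessian quadratic form `∇²m(x)(v,v)`. -/
def hess (m : ℝ × ℝ → ℝ) (x v : ℝ × ℝ) : ℝ := fderiv ℝ (fun z => fderiv ℝ m z v) x v

theorem taylor_aux (m : ℝ × ℝ → ℝ) (hm : ContDiff ℝ (⊤ : ℕ∞) m) (a v : ℝ × ℝ) (c : ℝ) :
    c ^ 2 * ∫ τ in (0:ℝ)..1, (1 - τ) * hess m (a + (τ * c) • v) v
      = m (a + c • v) - c * fderiv ℝ m a v - m a := by
  have hg : ContDiff ℝ (⊤ : ℕ∞) (fun z => fderiv ℝ m z v) :=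
    (hm.fderiv_right (m := (⊤ : ℕ∞)) (by simp)).clm_apply contDiff_const
  have hh : Continuous (fun z => fderiv ℝ (fun z => fderiv ℝ m z v) z v) :=
    (hg.continuous_fderiv (by simp)).clm_apply continuous_const
  have hl : ∀ τ : ℝ, HasDerivAt (fun τ : ℝ => a + (τ * c) • v) (c • v) τ := by
    intro τ
    have := (((hasDerivAt_id τ).mul_const c).smul_const v).const_add a
    simpa using this
  have hf : ∀ τ : ℝ, HasDerivAt (fun τ : ℝ => m (a + (τ * c) • v))
      (c * fderiv ℝ m (a + (τ * c) • v) v) τ := by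
    intro τ
    have h1 := ((hm.differentiable (by simp)) (a + (τ * c) • v)).hasFDerivAt
    exact (h1.comp_hasDerivAt τ (hl τ)).congr_deriv (by simp)
  have hf2 : ∀ τ : ℝ, HasDerivAt (fun τ : ℝ => fderiv ℝ m (a + (τ * c) • v) v)
      (c * hess m (a + (τ * c) • v) v) τ := by
    intro τ
    have h1 := ((hg.differentiable (by simp)) (a + (τ * c) • v)).hasFDerivAt
    have h2 := h1.comp_hasDerivAt τ (hl τ)
    rw [map_smul, smul_eq_mul] at h2
    exact h2
  have hF : ∀ τ ∈ Set.uIcc (0:ℝ) 1, HasDerivAt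
      (fun τ : ℝ => (1 - τ) * (c * fderiv ℝ m (a + (τ * c) • v) v) + m (a + (τ * c) • v))
      (c ^ 2 * ((1 - τ) * hess m (a + (τ * c) • v) v)) τ := by
    intro τ _
    have h1 : HasDerivAt (fun τ : ℝ => 1 - τ) (-1) τ := by
      simpa using (hasDerivAt_id τ).const_sub 1
    have := (h1.mul ((hf2 τ).const_mul c)).add (hf τ)
    exact this.congr_deriv (by ring)
  rw [← intervalIntegral.integral_const_mul,
    intervalIntegral.integral_eq_sub_of_hasDerivAt hF]
  · simp
    ring
  · apply Continuous.intervalIntegrable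
    unfold hess
    have : Continuous (fun τ : ℝ => a + (τ * c) • v) := by fun_prop
    have := hh.comp this
    simp only [Function.comp_def] at this
    fun_prop

theorem fderiv_eq_grad (m : ℝ × ℝ → ℝ) (x v : ℝ × ℝ) :
    fderiv ℝ m x v = v.1 * (grad2 m x).1 + v.2 * (grad2 m x).2 := by
  have : v = v.1 • ((1:ℝ), (0:ℝ)) + v.2 • ((0:ℝ), (1:ℝ)) := by
    ext <;> simp
  conv_lhs => rw [this]
  rw [map_add, map_smul, map_smul]
  simp [grad2]

theorem m_curve_zero (m : ℝ × ℝ → ℝ) (hm : ContDiff ℝ (⊤ : ℕ∞) m)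
    (γ : ℝ → ℝ × ℝ) (hc : CurveData m γ) (s : ℝ) : m (γ s) = 0 := by
  have hd : ∀ s, HasDerivAt (fun s => m (γ s)) 0 s := by
    intro s
    have h1 := ((hm.differentiable (by simp)) (γ s)).hasFDerivAt
    have h2 := ((hc.smooth.differentiable (by simp)) s).hasDerivAt
    have h3 := h1.comp_hasDerivAt s h2
    rw [hc.ode s, fderiv_eq_grad] at h3
    exact h3.congr_deriv (by simp [perp2]; ring)
  rw [← hc.start]
  exact is_const_of_deriv_eq_zero (fun s => (hd s).differentiableAt) (fun s => (hd s).deriv) s 0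

theorem fderiv_nu (m : ℝ × ℝ → ℝ) (γ : ℝ → ℝ × ℝ) (s : ℝ) :
    fderiv ℝ m (γ s) (nuVec m γ s) = enorm2 (grad2 m (γ s)) := by
  rw [fderiv_eq_grad]
  simp only [nuVec, enorm2, Prod.smul_fst, Prod.smul_snd, smul_eq_mul]
  set g := grad2 m (γ s)
  have h0 : 0 ≤ g.1 ^ 2 + g.2 ^ 2 := by positivity
  have h1 := Real.mul_self_sqrt h0
  by_cases hz : Real.sqrt (g.1 ^ 2 + g.2 ^ 2) = 0
  · simp [hz]
  · field_simp
    nlinarith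

/-- equation satisfied by the rescaled function `u(t,s,y) = ε^{1/4} φ(t,s,√ε y)`. -/
theorem stmt4
    (m : ℝ × ℝ → ℝ) (hm : ContDiff ℝ (⊤ : ℕ∞) m)
    (γ : ℝ → ℝ × ℝ) (hcurve : CurveData m γ)
    (K : ℝ) (hKsup : K = sSup (Set.range fun s => |curv m γ s|))
    (hKpos : 0 < K) (hKbdd : BddAbove (Set.range fun s => |curv m γ s|))
    (ε : ℝ) (hε : ε ∈ Set.Ioc (0:ℝ) 1)
    (δ : ℝ) (hδ : δ ∈ Set.Ioc (0:ℝ) (1/(4*K)))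
    (φ : ℝ → ℝ × ℝ → C2)
    (hφsmooth : ContDiffOn ℝ (⊤ : ℕ∞) (fun q : ℝ × (ℝ × ℝ) => φ q.1 q.2)
      (Set.univ ×ˢ (Set.univ ×ˢ Set.Ioo (-(1/(4*K))) (1/(4*K)))))
    (hφeqn : ∀ t s y, y ∈ Set.Ioo (-(1/(4*K))) (1/(4*K)) →
      (Complex.I * (ε : ℂ)) • deriv (fun τ => φ τ (s, y)) t = transOp ε m γ (φ t) (s, y))
    (u : ℝ → ℝ × ℝ → C2)
    (hu : ∀ t p, u t p = (ε ^ ((1:ℝ)/4) : ℝ) • φ t (p.1, Real.sqrt ε * p.2)) :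
    ∀ t s y, |y| < δ / Real.sqrt ε →
      (Complex.I * ((Real.sqrt ε : ℝ) : ℂ)) • deriv (fun τ => u τ (s, y)) t
        = ((y * enorm2 (grad2 m (γ s)) : ℝ) : ℂ) • pauli1.mulVec (u t (s, y))
          + Complex.I • pauli2.mulVec (pdy (u t) (s, y))
          - (Complex.I * ((Real.sqrt ε : ℝ) : ℂ)
              / ((1 - Real.sqrt ε * y * curv m γ s : ℝ) : ℂ)) • pauli3.mulVec (pdx (u t) (s, y))
          - (Complex.I * (ε : ℂ) * (y : ℂ) * ((deriv (curv m γ) s : ℝ) : ℂ)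
              / ((2 * (1 - Real.sqrt ε * y * curv m γ s)^2 : ℝ) : ℂ)) • pauli3.mulVec (u t (s, y))
          + ((Real.sqrt ε * y^2 *
              ∫ τ in (0:ℝ)..1, (1 - τ) *
                hess m (tubeMap m γ (s, τ * (Real.sqrt ε * y))) (nuVec m γ s) : ℝ) : ℂ) •
              pauli1.mulVec (u t (s, y)) := by
  intro t s y hy
  set r := Real.sqrt ε with hr
  have hε0 : 0 < ε := hε.1
  have hr0 : 0 < r := Real.sqrt_pos.mpr hε0
  have hrr : r * r = ε := Real.mul_self_sqrt hε0.le
  have hyI : r * y ∈ Set.Ioo (-(1/(4*K))) (1/(4*K)) := by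
    have h1 : |r * y| < δ := by
      rw [abs_mul, abs_of_pos hr0, mul_comm]
      exact (lt_div_iff₀ hr0).mp hy
    exact abs_lt.mp (h1.trans_le hδ.2)
  have hopen : IsOpen ((Set.univ : Set ℝ) ×ˢ ((Set.univ : Set ℝ) ×ˢ
      Set.Ioo (-(1/(4*K))) (1/(4*K)))) :=
    isOpen_univ.prod (isOpen_univ.prod isOpen_Ioo)
  have hdiff : DifferentiableAt ℝ (fun q : ℝ × (ℝ × ℝ) => φ q.1 q.2) (t, (s, r * y)) :=
    (hφsmooth.contDiffAt (hopen.mem_nhds ⟨trivial, trivial, hyI⟩)).differentiableAt (by simp)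
  have hdx : DifferentiableAt ℝ (φ t) (s, r * y) := by
    have h2 : DifferentiableAt ℝ (fun p : ℝ × ℝ => (t, p)) (s, r * y) := by fun_prop
    exact DifferentiableAt.comp (g := fun q : ℝ × (ℝ × ℝ) => φ q.1 q.2) (s, r * y) hdiff h2
  have hdt : DifferentiableAt ℝ (fun τ => φ τ (s, r * y)) t := by
    have h2 : DifferentiableAt ℝ (fun τ : ℝ => (τ, (s, r * y))) t := by fun_prop
    exact DifferentiableAt.comp (g := fun q : ℝ × (ℝ × ℝ) => φ q.1 q.2) t hdiff h2
  set k : ℝ := ε ^ ((1:ℝ)/4) with hk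
  have hut : deriv (fun τ => u τ (s, y)) t = k • deriv (fun τ => φ τ (s, r * y)) t := by
    have : (fun τ => u τ (s, y)) = fun τ => k • φ τ (s, r * y) := by
      funext τ; rw [hu]
    rw [this]
    exact (hdt.hasDerivAt.const_smul k).deriv
  let L : ℝ × ℝ →L[ℝ] ℝ × ℝ :=
    (ContinuousLinearMap.fst ℝ ℝ ℝ).prod (r • ContinuousLinearMap.snd ℝ ℝ ℝ)
  have hux : HasFDerivAt (u t) (k • (fderiv ℝ (φ t) (s, r * y)).comp L) (s, y) := by
    have e : u t = fun p => k • φ t (L p) := by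
      funext p; rw [hu]; rfl
    rw [e]
    have hφ : HasFDerivAt (φ t) (fderiv ℝ (φ t) (s, r * y)) (L (s, y)) := hdx.hasFDerivAt
    exact (hφ.comp (s, y) L.hasFDerivAt).const_smul k
  have hpx : pdx (u t) (s, y) = k • pdx (φ t) (s, r * y) := by
    unfold pdx
    rw [hux.fderiv]
    simp [L]
  have hpy : pdy (u t) (s, y) = k • r • pdy (φ t) (s, r * y) := by
    unfold pdy
    rw [hux.fderiv]
    have : ((0:ℝ), r) = r • ((0:ℝ), (1:ℝ)) := by simp
    simp [L]
    rw [this, map_smul]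
  have hT := taylor_aux m hm (γ s) (nuVec m γ s) (r * y)
  rw [m_curve_zero m hm γ hcurve s, fderiv_nu] at hT
  have hE := hφeqn t s (r * y) hyI
  unfold transOp at hE
  simp only [tubeMap] at hE ⊢
  set J : ℝ := ∫ τ in (0:ℝ)..1, (1 - τ) *
    hess m (γ s + (τ * (r * y)) • nuVec m γ s) (nuVec m γ s) with hJ
  have hM : m (γ s + (r * y) • nuVec m γ s)
      = r * (y * enorm2 (grad2 m (γ s)) + r * y ^ 2 * J) := by
    linear_combination -hT
  rw [hut, hpx, hpy, hu]
  rw [hM, ← hrr] at hE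
  rw [← hrr]
  have hrC : (r : ℂ) ≠ 0 := by exact_mod_cast hr0.ne'
  generalize deriv (fun τ => φ τ (s, r * y)) t = A at *
  generalize pdx (φ t) (s, r * y) = B at *
  generalize pdy (φ t) (s, r * y) = C at *
  simp only at hE ⊢
  generalize φ t (s, r * y) = D at *
  generalize curv m γ s = κ at *
  generalize deriv (curv m γ) s = κ' at *
  generalize enorm2 (grad2 m (γ s)) = N at *
  clear_value J k r
  have key : ∀ i, _ := fun i => congrFun hE i
  ext i
  have hi := key i
  apply mul_left_cancel₀ hrC
  simp only [Matrix.mulVec_smul, Pi.add_apply, Pi.sub_apply, Pi.smul_apply, smul_eq_mul,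
    Complex.real_smul, Complex.ofReal_mul, Complex.ofReal_add, Complex.ofReal_pow] at hi ⊢
  linear_combination (k : ℂ) * hi
end
end

section
/- Let m ∈ C^∞(ℝ²,ℝ) have all derivatives bounded, and let χ ∈ C^∞(ℝ²,[0,1]) satisfy χ(ξ) = 0 for |ξ| < 1 and χ(ξ) = 1 for |ξ| > 2. Then there exists a constant C > 0, depending only on χ and on sup_{x}|∇m(x)|, such that for every ε ∈ (0,1], every R ≥ 1, every classical solution ψ of the Dirac equation with parameter ε, and every t ∈ ℝ: ‖χ_{ε,R}(D) ψ(t,·)‖_{L²(ℝ²,ℂ²)} ≤ ‖χ_{ε,R}(D) ψ(0,·)‖_{L²(ℝ²,ℂ²)} + (C|t|/R) ‖ψ(0,·)‖_{L²(ℝ²,ℂ²)}, where χ_{ε,R}(D) is the Fourier multiplier with symbol ξ ↦ χ(εξ/R). (Conservation of ε-oscillation.) -/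
open MeasureTheory Complex

noncomputable section

def l2normC2 (g : ℝ × ℝ → C2) : ℝ := Real.sqrt (∫ x : ℝ × ℝ, (‖g x 0‖ ^ 2 + ‖g x 1‖ ^ 2))

/-- Fourier transform on ℝ² (unitary convention `(2π)⁻¹ ∫ e^{-ix·ξ}`). -/
def ft2 (g : ℝ × ℝ → ℂ) (ξ : ℝ × ℝ) : ℂ :=
  ((2 * Real.pi : ℝ) : ℂ)⁻¹ *
    ∫ x : ℝ × ℝ, Complex.exp (-(Complex.I * ((x.1 * ξ.1 + x.2 * ξ.2 : ℝ) : ℂ))) * g x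

/-- Inverse Fourier transform on ℝ². -/
def ift2 (h : ℝ × ℝ → ℂ) (x : ℝ × ℝ) : ℂ :=
  ((2 * Real.pi : ℝ) : ℂ)⁻¹ *
    ∫ ξ : ℝ × ℝ, Complex.exp (Complex.I * ((x.1 * ξ.1 + x.2 * ξ.2 : ℝ) : ℂ)) * h ξ

/-- Fourier multiplier `b(D)` acting componentwise on ℂ²-valued functions. -/
def fmult (b : ℝ × ℝ → ℂ) (g : ℝ × ℝ → C2) (x : ℝ × ℝ) : C2 :=
  fun i => ift2 (fun ξ => b ξ * ft2 (fun z => g z i) ξ) x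

abbrev VV := WithLp 2 (ℝ × ℝ)

open scoped FourierTransform SchwartzMap ContDiff

def eVV : VV ≃L[ℝ] ℝ × ℝ := WithLp.prodContinuousLinearEquiv 2 ℝ ℝ ℝ

lemma eVV_mp : MeasurePreserving (fun v : VV => eVV v) :=
  WithLp.volume_preserving_ofLp (U := ℝ) (V := ℝ)

lemma eVV_integral (f : ℝ × ℝ → ℂ) : ∫ v : VV, f (eVV v) = ∫ x, f x :=
  eVV_mp.integral_comp eVV.toHomeomorph.measurableEmbedding f

lemma finrank_P : Module.finrank ℝ (ℝ × ℝ) = 2 := by simp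

lemma ift2_eq (h : ℝ × ℝ → ℂ) (x : ℝ × ℝ) :
    𝓕⁻ (fun w : VV => h ((2 * Real.pi) • eVV w)) (eVV.symm x)
      = ((2 * Real.pi : ℝ) : ℂ)⁻¹ * ift2 h x := by
  rw [Real.fourierInv_eq']
  have h1 := eVV_integral (fun ξ => Complex.exp (Complex.I *
      ((x.1 * ((2 * Real.pi) • ξ).1 + x.2 * ((2 * Real.pi) • ξ).2 : ℝ) : ℂ)) *
      h ((2 * Real.pi) • ξ))
  have h2 := Measure.integral_comp_smul (volume : Measure (ℝ × ℝ)) (fun ξ => Complex.exp (Complex.I *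
      ((x.1 * ξ.1 + x.2 * ξ.2 : ℝ) : ℂ)) * h ξ) (2 * Real.pi)
  rw [h2] at h1
  rw [ift2, ← mul_assoc]
  refine Eq.trans (integral_congr_ae (Filter.Eventually.of_forall fun v => ?_)) (h1.trans ?_)
  · simp only [smul_eq_mul]
    congr 2
    have : inner ℝ v (eVV.symm x) = v.fst * x.1 + v.snd * x.2 := by
      rw [WithLp.prod_inner_apply]
      simp [eVV, mul_comm]
    rw [this]
    have e1 : (eVV v).1 = v.fst := rfl
    have e2 : (eVV v).2 = v.snd := rfl
    simp only [Prod.smul_fst, Prod.smul_snd, e1, e2, smul_eq_mul]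
    push_cast
    ring
  · rw [finrank_P, abs_of_pos (by positivity), Complex.real_smul]
    congr 1
    push_cast
    rw [sq, mul_inv]

lemma ft2_eq (g : ℝ × ℝ → ℂ) (ξ : ℝ × ℝ) :
    ft2 g ((2 * Real.pi) • ξ) = ((2 * Real.pi : ℝ) : ℂ)⁻¹ * 𝓕 (fun w : VV => g (eVV w)) (eVV.symm ξ) := by
  rw [Real.fourier_eq', ft2]
  congr 1
  rw [← eVV_integral]
  refine integral_congr_ae (Filter.Eventually.of_forall fun v => ?_)
  simp only [smul_eq_mul]
  congr 2
  have : inner ℝ v (eVV.symm ξ) = v.fst * ξ.1 + v.snd * ξ.2 := by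
    rw [WithLp.prod_inner_apply]
    simp [eVV, mul_comm]
  rw [this]
  have e1 : (eVV v).1 = v.fst := rfl
  have e2 : (eVV v).2 = v.snd := rfl
  simp only [Prod.smul_fst, Prod.smul_snd, e1, e2, smul_eq_mul]
  push_cast
  ring

def pull (g : 𝓢(ℝ × ℝ, ℂ)) : 𝓢(VV, ℂ) := SchwartzMap.compCLMOfContinuousLinearEquiv ℂ eVV g
def push (g : 𝓢(VV, ℂ)) : 𝓢(ℝ × ℝ, ℂ) := SchwartzMap.compCLMOfContinuousLinearEquiv ℂ eVV.symm g

lemma ft2_eq' (g : 𝓢(ℝ × ℝ, ℂ)) (ξ : ℝ × ℝ) :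
    ft2 g ((2 * Real.pi) • ξ) = ((2 * Real.pi : ℝ) : ℂ)⁻¹ * push (𝓕 (pull g)) ξ := by
  rw [ft2_eq]
  rfl

lemma ft2_integrable (g : 𝓢(ℝ × ℝ, ℂ)) : Integrable (ft2 g) := by
  have h2 : (2 * Real.pi) ≠ 0 := by positivity
  rw [← integrable_comp_smul_iff volume _ h2]
  simp_rw [ft2_eq']
  exact ((push (𝓕 (pull g))).integrable).const_mul _

lemma ift2_ft2 (g : 𝓢(ℝ × ℝ, ℂ)) (x : ℝ × ℝ) : ift2 (ft2 g) x = g x := by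
  have h2 : ((2 * Real.pi : ℝ) : ℂ) ≠ 0 := by
    have : (2 * Real.pi) ≠ 0 := by positivity
    exact_mod_cast this
  have h := ift2_eq (ft2 g) x
  have h3 : (fun w : VV => ft2 g ((2 * Real.pi) • eVV w)) =
      (((2 * Real.pi : ℝ) : ℂ)⁻¹ • 𝓕 (pull g) : 𝓢(VV, ℂ)) := by
    ext w
    rw [ft2_eq']
    simp [push]
  rw [h3, ← SchwartzMap.fourierInv_coe] at h
  have h4 : 𝓕⁻ (((2 * Real.pi : ℝ) : ℂ)⁻¹ • 𝓕 (pull g)) = ((2 * Real.pi : ℝ) : ℂ)⁻¹ • pull g := by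
    rw [FourierTransform.fourierInv_smul, FourierTransform.fourierInv_fourier_eq]
  rw [h4] at h
  have h5 : (((2 * Real.pi : ℝ) : ℂ)⁻¹ • pull g) (eVV.symm x) = ((2 * Real.pi : ℝ) : ℂ)⁻¹ * g x := by
    simp [pull]
  rw [h5] at h
  exact (mul_left_cancel₀ (inv_ne_zero h2) h).symm

lemma kernel_exists (η : ℝ × ℝ → ℂ) (hη : ContDiff ℝ ∞ η) (hc : HasCompactSupport η) :
    ∃ κ : 𝓢(ℝ × ℝ, ℂ), ∀ z, κ z = ((2 * Real.pi : ℝ) : ℂ)⁻¹ * ift2 η z := by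
  have h2 : (2 * Real.pi) ≠ 0 := by positivity
  have c1 : HasCompactSupport (fun w : VV => η ((2 * Real.pi) • eVV w)) :=
    (hc.comp_smul h2).comp_homeomorph eVV.toHomeomorph
  have c2 : ContDiff ℝ ∞ (fun w : VV => η ((2 * Real.pi) • eVV w)) :=
    hη.comp (eVV.contDiff.const_smul _)
  refine ⟨push (𝓕⁻ (c1.toSchwartzMap c2)), fun z => ?_⟩
  rw [← ift2_eq]
  simp only [push, SchwartzMap.compCLMOfContinuousLinearEquiv_apply, Function.comp,
    SchwartzMap.fourierInv_coe]
  rfl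

lemma scaled_kernel (κ : 𝓢(ℝ × ℝ, ℂ)) (δ : ℝ) (hδ : 0 < δ) :
    ∃ k : 𝓢(ℝ × ℝ, ℂ), (∀ z, k z = (((δ ^ 2)⁻¹ : ℝ) : ℂ) * κ (δ⁻¹ • z)) ∧
      ∫ z, ‖z‖ * ‖k z‖ = δ * ∫ z, ‖z‖ * ‖κ z‖ := by
  have h : ∀ z : ℝ × ℝ, (((δ ^ 2)⁻¹ : ℝ) : ℂ) • SchwartzMap.compCLMOfContinuousLinearEquiv ℂ
    (ContinuousLinearEquiv.smulLeft (R₁ := ℝ) (M₁ := ℝ × ℝ) (Units.mk0 δ⁻¹ (inv_ne_zero hδ.ne'))) κ z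
    = (((δ ^ 2)⁻¹ : ℝ) : ℂ) * κ (δ⁻¹ • z) := fun z => rfl
  refine ⟨(((δ ^ 2)⁻¹ : ℝ) : ℂ) • SchwartzMap.compCLMOfContinuousLinearEquiv ℂ
    (ContinuousLinearEquiv.smulLeft (R₁ := ℝ) (M₁ := ℝ × ℝ) (Units.mk0 δ⁻¹ (inv_ne_zero hδ.ne'))) κ,
    h, ?_⟩
  have h1 := Measure.integral_comp_inv_smul_of_nonneg (volume : Measure (ℝ × ℝ))
    (fun z => ‖z‖ * ‖κ z‖) hδ.le
  rw [finrank_P] at h1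
  calc _ = ∫ z : ℝ × ℝ, (δ ^ 2)⁻¹ * δ * (‖δ⁻¹ • z‖ * ‖κ (δ⁻¹ • z)‖) := by
        refine integral_congr_ae (Filter.Eventually.of_forall fun z => ?_)
        simp only [_root_.smul_apply, h, norm_mul, Complex.norm_real, norm_smul, Real.norm_eq_abs,
          abs_of_pos (inv_pos.2 hδ), abs_of_pos (inv_pos.2 (pow_pos hδ 2))]
        field_simp
    _ = _ := by
        rw [integral_const_mul, h1, smul_eq_mul]
        field_simp

lemma fubini_part (η : ℝ × ℝ → ℂ) (hηi : Integrable η) (g : 𝓢(ℝ × ℝ, ℂ)) (x : ℝ × ℝ) :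
    ift2 (fun ξ => η ξ * ft2 g ξ) x = ∫ z, (((2 * Real.pi : ℝ) : ℂ)⁻¹ * ift2 η z) * g (x - z) := by
  have hgi : Integrable (fun y => g (x - y)) := g.integrable.comp_sub_left x
  calc _ = ((2 * Real.pi : ℝ) : ℂ)⁻¹ * ∫ ξ : ℝ × ℝ, ∫ z : ℝ × ℝ, ((2 * Real.pi : ℝ) : ℂ)⁻¹ *
        (Complex.exp (Complex.I * ((z.1 * ξ.1 + z.2 * ξ.2 : ℝ) : ℂ)) * (η ξ * g (x - z))) := by
        rw [ift2]
        congr 1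
        refine integral_congr_ae (Filter.Eventually.of_forall fun ξ => ?_)
        simp only [ft2]
        rw [← integral_sub_left_eq_self (fun y : ℝ × ℝ =>
          Complex.exp (-(Complex.I * ((y.1 * ξ.1 + y.2 * ξ.2 : ℝ) : ℂ))) * g y) volume x,
          integral_const_mul]
        rw [mul_left_comm (η ξ), mul_left_comm, ← integral_const_mul, ← integral_const_mul]
        congr 1
        refine integral_congr_ae (Filter.Eventually.of_forall fun z => ?_)
        simp only [Prod.fst_sub, Prod.snd_sub]
        have : Complex.exp (Complex.I * ((z.1 * ξ.1 + z.2 * ξ.2 : ℝ) : ℂ)) =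
          Complex.exp (Complex.I * ((x.1 * ξ.1 + x.2 * ξ.2 : ℝ) : ℂ)) *
          Complex.exp (-(Complex.I * (((x.1 - z.1) * ξ.1 + (x.2 - z.2) * ξ.2 : ℝ) : ℂ))) := by
          rw [← Complex.exp_add]
          congr 1
          push_cast
          ring
        rw [this]
        ring
    _ = ((2 * Real.pi : ℝ) : ℂ)⁻¹ * ∫ z : ℝ × ℝ, ∫ ξ : ℝ × ℝ, ((2 * Real.pi : ℝ) : ℂ)⁻¹ *
        (Complex.exp (Complex.I * ((z.1 * ξ.1 + z.2 * ξ.2 : ℝ) : ℂ)) * (η ξ * g (x - z))) := by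
        rw [integral_integral_swap]
        refine Integrable.const_mul ?_ _
        refine (hηi.mul_prod hgi).bdd_mul (c := 1) ?_ ?_
        · apply Continuous.aestronglyMeasurable
          fun_prop
        · refine Filter.Eventually.of_forall fun p => ?_
          rw [mul_comm Complex.I, Complex.norm_exp_ofReal_mul_I]
    _ = _ := by
        rw [← integral_const_mul]
        refine integral_congr_ae (Filter.Eventually.of_forall fun z => ?_)
        simp only [ift2]
        rw [integral_const_mul, ← mul_assoc, mul_assoc _ _ (g (x - z)), mul_assoc _ _ (g (x - z)),
          ← integral_mul_const, mul_assoc]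
        simp only [mul_assoc]

lemma ift2_scale (η : ℝ × ℝ → ℂ) (δ : ℝ) (hδ : 0 < δ) (z : ℝ × ℝ) :
    ift2 (fun ξ => η (δ • ξ)) z = (((δ ^ 2)⁻¹ : ℝ) : ℂ) * ift2 η (δ⁻¹ • z) := by
  have h2 := Measure.integral_comp_smul (volume : Measure (ℝ × ℝ)) (fun ξ => Complex.exp (Complex.I *
      (((δ⁻¹ • z).1 * ξ.1 + (δ⁻¹ • z).2 * ξ.2 : ℝ) : ℂ)) * η ξ) δ
  rw [finrank_P, abs_of_pos (by positivity), Complex.real_smul] at h2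
  rw [ift2, ift2, mul_left_comm, ← h2]
  congr 1
  refine integral_congr_ae (Filter.Eventually.of_forall fun ξ => ?_)
  simp only [Prod.smul_fst, Prod.smul_snd, smul_eq_mul]
  congr 4
  field_simp

theorem fourier_part
    (χ : ℝ × ℝ → ℝ) (hχ : ContDiff ℝ (⊤ : ℕ∞) χ)
    (hχ1 : ∀ ξ, 2 < enorm2 ξ → χ ξ = 1) :
    ∃ c : ℝ, 0 ≤ c ∧ ∀ δ : ℝ, 0 < δ → ∃ k : 𝓢(ℝ × ℝ, ℂ), ∫ z, ‖z‖ * ‖k z‖ = δ * c ∧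
      ∀ (g : 𝓢(ℝ × ℝ, ℂ)) (x : ℝ × ℝ),
        ift2 (fun ξ => ((χ (δ • ξ) : ℝ) : ℂ) * ft2 g ξ) x = g x - ∫ z, k z * g (x - z) := by
  set η : ℝ × ℝ → ℂ := fun ξ => ((1 - χ ξ : ℝ) : ℂ) with hηdef
  have hη : ContDiff ℝ ∞ η := Complex.ofRealCLM.contDiff.comp (contDiff_const.sub hχ)
  have hc : HasCompactSupport η := by
    refine HasCompactSupport.intro (isCompact_closedBall (0 : ℝ × ℝ) 2) fun ξ hξ => ?_
    rw [hηdef]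
    simp only
    rw [hχ1 ξ, sub_self, Complex.ofReal_zero]
    rw [mem_closedBall_zero_iff, not_le, Prod.norm_def, lt_max_iff] at hξ
    rw [enorm2]
    refine Real.lt_sqrt_of_sq_lt ?_
    rcases hξ with h | h
    · rw [Real.norm_eq_abs] at h
      nlinarith [sq_abs ξ.1, sq_nonneg ξ.2]
    · rw [Real.norm_eq_abs] at h
      nlinarith [sq_abs ξ.2, sq_nonneg ξ.1]
  obtain ⟨κ, hκ⟩ := kernel_exists η hη hc
  refine ⟨∫ z, ‖z‖ * ‖κ z‖, integral_nonneg fun z => by positivity, fun δ hδ => ?_⟩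
  obtain ⟨k, hk, hki⟩ := scaled_kernel κ δ hδ
  refine ⟨k, hki, fun g x => ?_⟩
  have hηδ : Continuous (fun ξ => η (δ • ξ)) := hη.continuous.comp (continuous_const_smul δ)
  have hηδi : Integrable (fun ξ => η (δ • ξ)) :=
    (integrable_comp_smul_iff volume _ hδ.ne').2 (hη.continuous.integrable_of_hasCompactSupport hc)
  have h1 := fubini_part _ hηδi g x
  have h2 : (fun ξ => ((χ (δ • ξ) : ℝ) : ℂ) * ft2 g ξ) =
      fun ξ => ft2 g ξ - η (δ • ξ) * ft2 g ξ := by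
    ext ξ
    simp only [hηdef]
    push_cast
    ring
  have hB : ∃ B, ∀ ξ, ‖η ξ‖ ≤ B := hc.exists_bound_of_continuous hη.continuous
  obtain ⟨B, hB⟩ := hB
  have hint : Integrable (fun ξ => η (δ • ξ) * ft2 g ξ) :=
    (ft2_integrable g).bdd_mul hηδ.aestronglyMeasurable (Filter.Eventually.of_forall fun ξ => hB _)
  have hexp : ∀ f : ℝ × ℝ → ℂ, Integrable f →
      Integrable (fun ξ => Complex.exp (Complex.I * ((x.1 * ξ.1 + x.2 * ξ.2 : ℝ) : ℂ)) * f ξ) := by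
    intro f hf
    refine hf.bdd_mul (c := 1) (Continuous.aestronglyMeasurable (by fun_prop)) ?_
    refine Filter.Eventually.of_forall fun p => ?_
    rw [mul_comm Complex.I, Complex.norm_exp_ofReal_mul_I]
  have h3 : ift2 (fun ξ => ft2 g ξ - η (δ • ξ) * ft2 g ξ) x =
      ift2 (ft2 g) x - ift2 (fun ξ => η (δ • ξ) * ft2 g ξ) x := by
    simp only [ift2, mul_sub]
    rw [integral_sub (hexp _ (ft2_integrable g)) (hexp _ hint), mul_sub]
  rw [h2, h3, ift2_ft2, h1]
  congr 1
  refine integral_congr_ae (Filter.Eventually.of_forall fun z => ?_)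
  simp only [hk, hκ, ift2_scale η δ hδ]
  ring

open scoped ENNReal

lemma cs_lintegral (k f : ℝ × ℝ → ℝ≥0∞) (hk : Measurable k) (hf : Measurable f) :
    (∫⁻ z, k z * f z) ^ 2 ≤ (∫⁻ z, k z) * ∫⁻ z, k z * f z ^ 2 := by
  have h := ENNReal.lintegral_mul_le_Lp_mul_Lq (volume : Measure (ℝ × ℝ))
    (f := fun z => k z ^ (1 / 2 : ℝ)) (g := fun z => k z ^ (1 / 2 : ℝ) * f z)
    Real.HolderConjugate.two_two (hk.pow_const _).aemeasurable
    ((hk.pow_const _).mul hf).aemeasurable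
  have e1 : ∀ z, k z ^ (1 / 2 : ℝ) * (k z ^ (1 / 2 : ℝ) * f z) = k z * f z := by
    intro z
    rw [← mul_assoc, ← ENNReal.rpow_add_of_nonneg _ _ (by norm_num) (by norm_num)]
    norm_num
  have e2 : ∀ z, (k z ^ (1 / 2 : ℝ)) ^ (2 : ℝ) = k z := by
    intro z
    rw [← ENNReal.rpow_mul]
    norm_num
  have e3 : ∀ z, (k z ^ (1 / 2 : ℝ) * f z) ^ (2 : ℝ) = k z * f z ^ 2 := by
    intro z
    rw [ENNReal.mul_rpow_of_nonneg _ _ (by norm_num), e2, ENNReal.rpow_two]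
  simp only [Pi.mul_apply, e1, e2, e3] at h
  calc (∫⁻ z, k z * f z) ^ 2 ≤ ((∫⁻ z, k z) ^ (1 / 2 : ℝ) * (∫⁻ z, k z * f z ^ 2) ^ (1 / 2 : ℝ)) ^ 2 := by
        gcongr
    _ = _ := by
        rw [mul_pow, ← ENNReal.rpow_two, ← ENNReal.rpow_two, ← ENNReal.rpow_mul, ← ENNReal.rpow_mul]
        norm_num

lemma schur (k f : ℝ × ℝ → ℝ≥0∞) (hk : Measurable k) (hf : Measurable f) :
    ∫⁻ x, (∫⁻ z, k z * f (x - z)) ^ 2 ≤ (∫⁻ z, k z) ^ 2 * ∫⁻ x, f x ^ 2 := by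
  calc ∫⁻ x, (∫⁻ z, k z * f (x - z)) ^ 2
      ≤ ∫⁻ x, (∫⁻ z, k z) * ∫⁻ z, k z * f (x - z) ^ 2 := by
        gcongr with x
        exact cs_lintegral k (fun z => f (x - z)) hk (hf.comp (measurable_const.sub measurable_id))
    _ = (∫⁻ z, k z) * ∫⁻ x, ∫⁻ z, k z * f (x - z) ^ 2 := by
        rw [lintegral_const_mul]
        refine Measurable.lintegral_prod_right' (f := fun p : (ℝ × ℝ) × (ℝ × ℝ) =>
          k p.2 * f (p.1 - p.2) ^ 2) ?_
        exact (hk.comp measurable_snd).mul ((hf.comp measurable_sub).pow_const _)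
    _ = (∫⁻ z, k z) * ∫⁻ z, ∫⁻ x, k z * f (x - z) ^ 2 := by
        rw [lintegral_lintegral_swap]
        exact ((hk.comp measurable_snd).mul ((hf.comp measurable_sub).pow_const _)).aemeasurable
    _ = (∫⁻ z, k z) * ∫⁻ z, k z * ∫⁻ x, f x ^ 2 := by
        congr 1
        refine lintegral_congr fun z => ?_
        have hm : Measurable fun x => f (x - z) ^ 2 :=
          (hf.comp (measurable_id.sub measurable_const)).pow_const _
        rw [lintegral_const_mul _ hm, lintegral_sub_right_eq_self (fun x => f x ^ 2) z]
    _ = _ := by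
        rw [lintegral_mul_const _ hk, sq, mul_assoc]

abbrev EE := EuclideanSpace ℂ (Fin 2)

lemma eLpNorm_two_sq {F : Type*} [NormedAddCommGroup F] (f : ℝ × ℝ → F) :
    eLpNorm f 2 volume ^ 2 = ∫⁻ x, ‖f x‖ₑ ^ 2 := by
  have := eLpNorm_nnreal_pow_eq_lintegral (μ := (volume : Measure (ℝ × ℝ))) (f := f) (p := 2) (by norm_num)
  simpa using this

lemma schur_Lp {F G : Type*} [NormedAddCommGroup F] [NormedAddCommGroup G]
    (k : ℝ × ℝ → ℝ≥0∞) (hk : Measurable k) (f : ℝ × ℝ → F)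
    (hf : StronglyMeasurable f) (w : ℝ × ℝ → G)
    (hw : ∀ x, ‖w x‖ₑ ≤ ∫⁻ z, k z * ‖f (x - z)‖ₑ) :
    eLpNorm w 2 volume ≤ (∫⁻ z, k z) * eLpNorm f 2 volume := by
  have h : eLpNorm w 2 volume ^ 2 ≤ ((∫⁻ z, k z) * eLpNorm f 2 volume) ^ 2 := by
    rw [mul_pow, eLpNorm_two_sq, eLpNorm_two_sq]
    refine le_trans ?_ (schur k _ hk hf.enorm)
    gcongr with x
    exact hw x
  exact (ENNReal.pow_le_pow_left_iff (by norm_num)).1 h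

def cv (k : ℝ × ℝ → ℂ) (f : ℝ × ℝ → EE) (x : ℝ × ℝ) : EE := ∫ z, k z • f (x - z)

open scoped SchwartzMap

lemma cv_enorm_le (k : ℝ × ℝ → ℂ) (f : ℝ × ℝ → EE) (x : ℝ × ℝ) :
    ‖cv k f x‖ₑ ≤ ∫⁻ z, ‖k z‖ₑ * ‖f (x - z)‖ₑ := by
  refine (enorm_integral_le_lintegral_enorm _).trans ?_
  simp [enorm_smul]

lemma cv_sm (k : 𝓢(ℝ × ℝ, ℂ)) (f : ℝ × ℝ → EE) (hf : StronglyMeasurable f) :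
    StronglyMeasurable (cv k f) := by
  refine StronglyMeasurable.integral_prod_right (E := EE) (f := fun x z => k z • f (x - z)) ?_
  exact (k.continuous.comp continuous_snd).stronglyMeasurable.smul (hf.comp_measurable measurable_sub)

lemma k_lint (k : 𝓢(ℝ × ℝ, ℂ)) : (∫⁻ z, ‖k z‖ₑ) = ENNReal.ofReal (∫ z, ‖k z‖) := by
  rw [ofReal_integral_norm_eq_lintegral_enorm k.integrable]

lemma cv_bound (k : 𝓢(ℝ × ℝ, ℂ)) (f : ℝ × ℝ → EE) (hf : StronglyMeasurable f) :
    eLpNorm (cv k f) 2 volume ≤ ENNReal.ofReal (∫ z, ‖k z‖) * eLpNorm f 2 volume := by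
  rw [← k_lint]
  exact schur_Lp _ k.continuous.measurable.enorm f hf _ (cv_enorm_le k f)

lemma cv_memLp (k : 𝓢(ℝ × ℝ, ℂ)) (f : ℝ × ℝ → EE) (hf : StronglyMeasurable f)
    (h2 : MemLp f 2 volume) : MemLp (cv k f) 2 volume :=
  ⟨(cv_sm k f hf).aestronglyMeasurable,
    (cv_bound k f hf).trans_lt (ENNReal.mul_lt_top ENNReal.ofReal_lt_top h2.2)⟩

lemma cv_ae_int (k : 𝓢(ℝ × ℝ, ℂ)) (f : ℝ × ℝ → EE) (hf : StronglyMeasurable f)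
    (h2 : MemLp f 2 volume) : ∀ᵐ x, Integrable (fun z => k z • f (x - z)) := by
  have h := schur (fun z => ‖k z‖ₑ) (fun z => ‖f z‖ₑ) k.continuous.measurable.enorm hf.enorm
  have hfin : ∫⁻ x, (∫⁻ z, ‖k z‖ₑ * ‖f (x - z)‖ₑ) ^ 2 ≠ ⊤ := by
    refine (h.trans_lt ?_).ne
    rw [k_lint, ← eLpNorm_two_sq]
    exact ENNReal.mul_lt_top (ENNReal.pow_lt_top ENNReal.ofReal_lt_top) (ENNReal.pow_lt_top h2.2)
  have hm : Measurable fun x => (∫⁻ z, ‖k z‖ₑ * ‖f (x - z)‖ₑ) ^ 2 := by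
    refine Measurable.pow_const (Measurable.lintegral_prod_right' (f := fun p : (ℝ × ℝ) × (ℝ × ℝ) =>
          ‖k p.2‖ₑ * ‖f (p.1 - p.2)‖ₑ) ?_) _
    exact (k.continuous.measurable.enorm.comp measurable_snd).mul (hf.enorm.comp measurable_sub)
  filter_upwards [ae_lt_top hm hfin] with x hx
  refine ⟨(k.continuous.stronglyMeasurable.smul
    (hf.comp_measurable (measurable_const.sub measurable_id))).aestronglyMeasurable, ?_⟩
  rw [HasFiniteIntegral]
  simp only [enorm_smul]
  exact (ENNReal.pow_lt_top_iff.1 hx).resolve_right (by norm_num)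

lemma cv_congr (k : ℝ × ℝ → ℂ) {f g : ℝ × ℝ → EE} (h : f =ᵐ[volume] g) : cv k f = cv k g := by
  funext x
  refine integral_congr_ae ?_
  have := (quasiMeasurePreserving_sub_left volume x).ae_eq h
  filter_upwards [this] with z hz
  simp only [Function.comp] at hz
  rw [hz]

def Kop (k : 𝓢(ℝ × ℝ, ℂ)) : Lp EE 2 (volume : Measure (ℝ × ℝ)) →L[ℂ] Lp EE 2 (volume : Measure (ℝ × ℝ)) :=
  LinearMap.mkContinuous
    { toFun := fun f => (cv_memLp k f (Lp.stronglyMeasurable f) (Lp.memLp f)).toLp (cv k f)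
      map_add' := by
        intro f g
        rw [← MemLp.toLp_add]
        refine (MemLp.toLp_eq_toLp_iff _ _).2 ?_
        rw [cv_congr k (Lp.coeFn_add f g)]
        filter_upwards [cv_ae_int k f (Lp.stronglyMeasurable f) (Lp.memLp f),
          cv_ae_int k g (Lp.stronglyMeasurable g) (Lp.memLp g)] with x hf hg
        simp only [cv, Pi.add_apply, smul_add]
        exact integral_add hf hg
      map_smul' := by
        intro c f
        rw [RingHom.id_apply, ← MemLp.toLp_const_smul]
        refine (MemLp.toLp_eq_toLp_iff _ _).2 ?_
        rw [cv_congr k (Lp.coeFn_smul c f)]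
        refine Filter.Eventually.of_forall fun x => ?_
        simp only [cv, Pi.smul_apply]
        rw [← integral_smul]
        simp_rw [smul_comm c] }
    (∫ z, ‖k z‖) (by
      intro f
      simp only [LinearMap.coe_mk, AddHom.coe_mk]
      rw [Lp.norm_toLp, Lp.norm_def]
      have h := cv_bound k f (Lp.stronglyMeasurable f)
      have h' := ENNReal.toReal_mono (ENNReal.mul_ne_top ENNReal.ofReal_ne_top (Lp.eLpNorm_ne_top f)) h
      rwa [ENNReal.toReal_mul, ENNReal.toReal_ofReal (integral_nonneg fun z => norm_nonneg _)] at h')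

lemma Kop_ae (k : 𝓢(ℝ × ℝ, ℂ)) (F : Lp EE 2 (volume : Measure (ℝ × ℝ))) (f : ℝ × ℝ → EE)
    (h : F =ᵐ[volume] f) : Kop k F =ᵐ[volume] cv k f := by
  rw [← cv_congr k h]
  exact MemLp.coeFn_toLp (cv_memLp k F (Lp.stronglyMeasurable F) (Lp.memLp F))


lemma int_ksmul (k : 𝓢(ℝ × ℝ, ℂ)) (g : ℝ × ℝ → EE) (hg : Continuous g) (B : ℝ)
    (hB : ∀ x, ‖g x‖ ≤ B) (x : ℝ × ℝ) : Integrable (fun z => k z • g (x - z)) := by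
  have h1 : Integrable (fun z => B * ‖k z‖) := k.integrable.norm.const_mul B
  refine h1.mono' ?_ (Filter.Eventually.of_forall fun z => ?_)
  · exact (k.continuous.smul (hg.comp (continuous_const.sub continuous_id))).aestronglyMeasurable
  · rw [norm_smul, mul_comm]
    gcongr
    exact hB _

lemma schwartz_bdd (u : 𝓢(ℝ × ℝ, EE)) : ∃ B, ∀ x, ‖u x‖ ≤ B := by
  obtain ⟨C, hC⟩ := u.decay' 0 0
  exact ⟨C, fun x => by
    have := hC x
    simp only [pow_zero, one_mul, norm_iteratedFDeriv_zero] at this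
    exact this⟩

lemma int_ksmul' (k : 𝓢(ℝ × ℝ, ℂ)) (u : 𝓢(ℝ × ℝ, EE)) (x : ℝ × ℝ) :
    Integrable (fun z => k z • u (x - z)) := by
  obtain ⟨B, hB⟩ := schwartz_bdd u
  exact int_ksmul k u u.continuous B hB x

open scoped LineDeriv

lemma schwartz_lineDeriv (u : 𝓢(ℝ × ℝ, EE)) (e x : ℝ × ℝ) :
    HasLineDerivAt ℝ u ((∂_{e} u : 𝓢(ℝ × ℝ, EE)) x) x e := by
  rw [SchwartzMap.lineDerivOp_apply_eq_fderiv]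
  exact (u.differentiableAt.hasFDerivAt).hasLineDerivAt e

lemma cv_lineDeriv (k : 𝓢(ℝ × ℝ, ℂ)) (u : 𝓢(ℝ × ℝ, EE)) (e x : ℝ × ℝ) :
    HasLineDerivAt ℝ (cv k u) (cv k (∂_{e} u : 𝓢(ℝ × ℝ, EE)) x) x e := by
  obtain ⟨B, hB⟩ := schwartz_bdd (∂_{e} u : 𝓢(ℝ × ℝ, EE))
  have h1 : Integrable (fun z => ‖k z‖ * B) := k.integrable.norm.mul_const B
  have := (hasDerivAt_integral_of_dominated_loc_of_deriv_le (𝕜 := ℝ) (μ := (volume : Measure (ℝ × ℝ)))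
    (F := fun t z => k z • u (x + t • e - z))
    (F' := fun t z => k z • (∂_{e} u : 𝓢(ℝ × ℝ, EE)) (x + t • e - z)) (x₀ := 0) (s := Set.univ)
    (bound := fun z => ‖k z‖ * B) Filter.univ_mem
    (Filter.Eventually.of_forall fun t => (int_ksmul' k u _).aestronglyMeasurable)
    (int_ksmul' k u _) (int_ksmul' k _ _).aestronglyMeasurable
    (Filter.Eventually.of_forall fun z t _ => by
      rw [norm_smul]
      gcongr
      exact hB _) h1
    (Filter.Eventually.of_forall fun z t _ => by
      refine HasDerivAt.const_smul (k z) ?_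
      have := schwartz_lineDeriv u e (x + t • e - z)
      rw [HasLineDerivAt] at this
      have h2 : HasDerivAt (fun s : ℝ => s - t) 1 t := (hasDerivAt_id t).sub_const t
      rw [← sub_self t] at this
      have h3 := HasDerivAt.scomp (h := fun s : ℝ => s - t) t this h2
      rw [one_smul] at h3
      refine h3.congr_of_eventuallyEq (Filter.Eventually.of_forall fun s => ?_)
      simp only [Function.comp]
      congr 1
      module)).2
  rw [HasLineDerivAt]
  simpa [cv] using this

lemma int_inner {f g : ℝ × ℝ → EE} (hf : MemLp f 2 volume) (hg : MemLp g 2 volume) :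
    Integrable (fun x => inner ℝ (f x) (g x)) := by
  refine (L2.integrable_inner (𝕜 := ℝ) (hf.toLp f) (hg.toLp g)).congr ?_
  filter_upwards [hf.coeFn_toLp, hg.coeFn_toLp] with x h1 h2
  rw [h1, h2]

lemma ibp (S : EE →L[ℂ] EE) (hS : ∀ v w : EE, inner ℝ (S v) w = inner ℝ v (S w)) (v v' : ℝ × ℝ → EE)
    (hv : MemLp v 2 volume) (hv' : MemLp v' 2 volume) (e : ℝ × ℝ)
    (h : ∀ x, HasLineDerivAt ℝ v (v' x) x e) : ∫ x, inner ℝ (v x) (S (v' x)) = 0 := by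
  have hSv : MemLp (fun x => S (v x)) 2 volume := S.comp_memLp' hv
  have hSv' : MemLp (fun x => S (v' x)) 2 volume := S.comp_memLp' hv'
  have key : ∫ x, inner ℝ (v x) (S (v' x)) = - ∫ x, inner ℝ (v' x) (S (v x)) := integral_bilinear_hasLineDerivAt_right_eq_neg_left_of_integrable
    (μ := (volume : Measure (ℝ × ℝ)))
    (f := v) (f' := v') (g := fun x => S (v x)) (g' := fun x => S (v' x)) (v := e)
    (B := innerSL ℝ) (int_inner hv' hSv) (int_inner hv hSv')
    (int_inner hv hSv) (fun x _ => h x)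
    (fun x _ => by
      have := h x
      rw [HasLineDerivAt] at this ⊢
      exact (S.restrictScalars ℝ).hasFDerivAt.comp_hasDerivAt 0 this)
  have h2 : ∫ x, inner ℝ (v' x) (S (v x)) = ∫ x, inner ℝ (v x) (S (v' x)) := by
    refine integral_congr_ae (Filter.Eventually.of_forall fun x => ?_)
    simp only
    rw [← hS, real_inner_comm]
  linarith

def sg (M : Matrix (Fin 2) (Fin 2) ℂ) : EE →L[ℂ] EE := Matrix.toEuclideanCLM (𝕜 := ℂ) M

lemma sg1_symm (v w : EE) : inner ℝ (sg pauli1 v) w = inner ℝ v (sg pauli1 w) := by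
  simp [sg, pauli1, PiLp.inner_apply, Matrix.ofLp_toEuclideanCLM, Fin.sum_univ_two, Matrix.vecHead, Matrix.vecTail, Complex.inner]
  ring
lemma sg2_symm (v w : EE) : inner ℝ (sg pauli2 v) w = inner ℝ v (sg pauli2 w) := by
  simp [sg, pauli2, PiLp.inner_apply, Matrix.ofLp_toEuclideanCLM, Fin.sum_univ_two, Matrix.vecHead, Matrix.vecTail, Complex.inner]
  ring
lemma sg3_zero (c : ℝ) (v : EE) : inner ℝ v ((Complex.I * (c : ℂ)) • sg pauli3 v) = 0 := by
  simp [sg, pauli3, PiLp.inner_apply, Matrix.ofLp_toEuclideanCLM, Fin.sum_univ_two, Matrix.vecHead, Matrix.vecTail, Complex.inner]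
  ring
lemma sg3_norm (v : EE) : ‖sg pauli3 v‖ = ‖v‖ := by
  rw [EuclideanSpace.norm_eq, EuclideanSpace.norm_eq]
  simp [sg, pauli3, Matrix.ofLp_toEuclideanCLM, Fin.sum_univ_two, Matrix.vecHead, Matrix.vecTail]

lemma energy {X : Type*} [NormedAddCommGroup X] [InnerProductSpace ℝ X] (G G' : ℝ → X) (c : ℝ)
    (hc : 0 ≤ c)
    (hG : ∀ t, HasDerivAt G (G' t) t) (h : ∀ t, |inner ℝ (G t) (G' t)| ≤ c * ‖G t‖) (t : ℝ) :
    ‖G t‖ ≤ ‖G 0‖ + c * |t| := by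
  refine le_of_forall_pos_le_add fun η hη => ?_
  have hpos : ∀ s, 0 < ‖G s‖ ^ 2 + η ^ 2 := fun s => by positivity
  have hd : ∀ s, HasDerivAt (fun s => Real.sqrt (‖G s‖ ^ 2 + η ^ 2))
      (2 * inner ℝ (G s) (G' s) / (2 * Real.sqrt (‖G s‖ ^ 2 + η ^ 2))) s := fun s =>
    (((hG s).norm_sq).add_const (η ^ 2)).sqrt (hpos s).ne'
  have hb := Convex.norm_image_sub_le_of_norm_hasDerivWithin_le (s := Set.univ) (x := (0 : ℝ)) (y := t)
    (C := c)
    (fun s _ => (hd s).hasDerivWithinAt) (fun s _ => by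
      rw [mul_div_mul_left _ _ two_ne_zero, Real.norm_eq_abs, abs_div, abs_of_pos (Real.sqrt_pos.2 (hpos s)),
        div_le_iff₀ (Real.sqrt_pos.2 (hpos s))]
      refine (h s).trans ?_
      gcongr
      exact Real.le_sqrt_of_sq_le (by nlinarith [sq_nonneg η])) convex_univ (Set.mem_univ _) (Set.mem_univ _)
  rw [sub_zero, Real.norm_eq_abs, Real.norm_eq_abs] at hb
  have h1 : ‖G t‖ ≤ Real.sqrt (‖G t‖ ^ 2 + η ^ 2) := Real.le_sqrt_of_sq_le (by nlinarith [sq_nonneg η])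
  have h2 : Real.sqrt (‖G 0‖ ^ 2 + η ^ 2) ≤ ‖G 0‖ + η := by
    rw [Real.sqrt_le_left (by positivity)]
    nlinarith [norm_nonneg (G 0)]
  have := le_abs_self (Real.sqrt (‖G t‖ ^ 2 + η ^ 2) - Real.sqrt (‖G 0‖ ^ 2 + η ^ 2))
  linarith

lemma deriv_ae (H : ℝ → Lp EE 2 (volume : Measure (ℝ × ℝ))) (H' : Lp EE 2 (volume : Measure (ℝ × ℝ)))
    (t : ℝ) (hH : HasDerivAt H H' t) (φ : ℝ → ℝ × ℝ → EE) (hφ : ∀ τ, H τ =ᵐ[volume] φ τ)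
    (d : ℝ × ℝ → EE) (hd : ∀ x, HasDerivAt (fun τ => φ τ x) (d x) t) : H' =ᵐ[volume] d := by
  have hseq : Filter.Tendsto (fun n : ℕ => 1 / ((n : ℝ) + 1)) Filter.atTop (nhdsWithin 0 {0}ᶜ) := by
    refine tendsto_nhdsWithin_iff.2 ⟨tendsto_one_div_add_atTop_nhds_zero_nat,
      Filter.Eventually.of_forall fun n => ?_⟩
    simp only [Set.mem_compl_iff, Set.mem_singleton_iff]
    positivity
  have h1 := (hasDerivAt_iff_tendsto_slope_zero.1 hH).comp hseq
  obtain ⟨ns, hns, hae⟩ := (tendstoInMeasure_of_tendsto_Lp h1).exists_seq_tendsto_ae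
  have hall : ∀ᵐ x, ∀ n : ℕ, ((fun s : ℝ => s⁻¹ • (H (t + s) - H t)) (1 / ((n : ℝ) + 1)) :
      Lp EE 2 (volume : Measure (ℝ × ℝ))) x =
      (1 / ((n : ℝ) + 1))⁻¹ • (φ (t + 1 / ((n : ℝ) + 1)) x - φ t x) := by
    rw [ae_all_iff]
    intro n
    filter_upwards [Lp.coeFn_smul ((1 / ((n : ℝ) + 1))⁻¹) (H (t + 1 / ((n : ℝ) + 1)) - H t),
      Lp.coeFn_sub (H (t + 1 / ((n : ℝ) + 1))) (H t), hφ (t + 1 / ((n : ℝ) + 1)), hφ t] with x a1 a2 a3 a4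
    rw [a1, Pi.smul_apply, a2, Pi.sub_apply, a3, a4]
  filter_upwards [hae, hall] with x hx hx2
  have h2 := ((hasDerivAt_iff_tendsto_slope_zero.1 (hd x)).comp hseq).comp hns.tendsto_atTop
  refine tendsto_nhds_unique hx (h2.congr fun n => ?_)
  simp only [Function.comp]
  exact (hx2 (ns n)).symm

lemma cv_sg (k : 𝓢(ℝ × ℝ, ℂ)) (S : EE →L[ℂ] EE) (g : ℝ × ℝ → EE) (x : ℝ × ℝ)
    (h : Integrable (fun z => k z • g (x - z))) : ∫ z, k z • S (g (x - z)) = S (cv k g x) := by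
  rw [cv, ← S.integral_comp_comm h]
  simp only [map_smul]

lemma comm_bound (m : ℝ × ℝ → ℝ) (L' : ℝ) (hL0 : 0 ≤ L')
    (hL : ∀ x z, |m (x - z) - m x| ≤ L' * ‖z‖) (ε : ℝ) (hε : 0 < ε) (k : 𝓢(ℝ × ℝ, ℂ))
    (u : 𝓢(ℝ × ℝ, EE)) (mu : ℝ × ℝ → EE) (hmu : mu = fun x => (m x : ℂ) • u x)
    (imu : ∀ x, Integrable (fun z => k z • mu (x - z))) (w : ℝ × ℝ → EE)
    (hw : w = fun x => (Complex.I * ((ε⁻¹ : ℝ) : ℂ)) • sg pauli3 (cv k mu x - (m x : ℂ) • cv k u x)) :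
    eLpNorm w 2 volume ≤ ENNReal.ofReal (L' / ε * ∫ z, ‖z‖ * ‖k z‖) * eLpNorm u 2 volume := by
  have iu := int_ksmul' k u
  have kint : Integrable (fun z => L' / ε * (‖z‖ * ‖k z‖)) := by
    have := (k.integrable_pow_mul volume 1).const_mul (L' / ε)
    simpa using this
  rw [← integral_const_mul, ofReal_integral_eq_lintegral_ofReal kint
    (Filter.Eventually.of_forall fun z => by positivity)]
  have hkc : Continuous (fun z => L' / ε * (‖z‖ * ‖k z‖)) :=
    continuous_const.mul (continuous_norm.mul k.continuous.norm)
  refine schur_Lp (fun z => ENNReal.ofReal (L' / ε * (‖z‖ * ‖k z‖))) hkc.measurable.ennreal_ofReal u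
    u.continuous.stronglyMeasurable w fun x => ?_
  have e1 : cv k mu x - (m x : ℂ) • cv k u x = ∫ z, (k z * ((m (x - z) - m x : ℝ) : ℂ)) • u (x - z) := by
    have iu' : Integrable (fun z => (m x : ℂ) • k z • u (x - z)) := (iu x).smul (m x : ℂ)
    rw [cv, cv, ← integral_smul, ← integral_sub (imu x) iu']
    refine integral_congr_ae (Filter.Eventually.of_forall fun z => ?_)
    simp only [hmu]
    push_cast
    module
  have e2 : ‖w x‖ₑ = ENNReal.ofReal ε⁻¹ *
      ‖∫ z, (k z * ((m (x - z) - m x : ℝ) : ℂ)) • u (x - z)‖ₑ := by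
    rw [← e1, ← ofReal_norm, ← ofReal_norm, ← ENNReal.ofReal_mul (by positivity)]
    simp only [hw]
    rw [norm_smul, sg3_norm, norm_mul, Complex.norm_I, one_mul, Complex.norm_real, Real.norm_eq_abs,
      abs_of_pos (inv_pos.2 hε)]
  rw [e2]
  calc _ ≤ ENNReal.ofReal ε⁻¹ * ∫⁻ z, ‖(k z * ((m (x - z) - m x : ℝ) : ℂ)) • u (x - z)‖ₑ := by
        gcongr
        exact enorm_integral_le_lintegral_enorm _
    _ = ∫⁻ z, ENNReal.ofReal ε⁻¹ * ‖(k z * ((m (x - z) - m x : ℝ) : ℂ)) • u (x - z)‖ₑ := by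
        rw [lintegral_const_mul' _ _ ENNReal.ofReal_ne_top]
    _ ≤ _ := by
        refine lintegral_mono fun z => ?_
        rw [enorm_smul, ← mul_assoc]
        refine mul_le_mul' ?_ le_rfl
        rw [← ofReal_norm, ← ENNReal.ofReal_mul (by positivity)]
        refine ENNReal.ofReal_le_ofReal ?_
        rw [norm_mul, Complex.norm_real, Real.norm_eq_abs]
        calc ε⁻¹ * (‖k z‖ * |m (x - z) - m x|) ≤ ε⁻¹ * (‖k z‖ * (L' * ‖z‖)) := by
              gcongr
              exact hL x z
          _ = _ := by ring

lemma w_sm (m : ℝ × ℝ → ℝ) (hm : Continuous m) (c : ℂ) (k : 𝓢(ℝ × ℝ, ℂ))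
    (u mu : ℝ × ℝ → EE) (hu : StronglyMeasurable u) (hmu : StronglyMeasurable mu) :
    StronglyMeasurable (fun x => c • sg pauli3 (cv k mu x - (m x : ℂ) • cv k u x)) := by
  have s1 := cv_sm k mu hmu
  have s2 := cv_sm k u hu
  have s3 : StronglyMeasurable (fun x => (m x : ℂ)) :=
    (Complex.continuous_ofReal.comp hm).stronglyMeasurable
  have s4 : StronglyMeasurable (fun x => (m x : ℂ) • cv k u x) := s3.smul s2
  have s5 : StronglyMeasurable (fun x => cv k mu x - (m x : ℂ) • cv k u x) := s1.sub s4
  have s6 : StronglyMeasurable (fun x => sg pauli3 (cv k mu x - (m x : ℂ) • cv k u x)) :=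
    (sg pauli3).continuous.comp_stronglyMeasurable s5
  exact s6.const_smul c

set_option maxHeartbeats 1000000 in
lemma core (m : ℝ × ℝ → ℝ) (hm : Continuous m) (B : ℝ) (hB : ∀ x, |m x| ≤ B) (L' : ℝ) (hL0 : 0 ≤ L')
    (hL : ∀ x z, |m (x - z) - m x| ≤ L' * ‖z‖) (ε : ℝ) (hε : 0 < ε) (k : 𝓢(ℝ × ℝ, ℂ))
    (u : 𝓢(ℝ × ℝ, EE)) (U U' : Lp EE 2 (volume : Measure (ℝ × ℝ))) (hU : U =ᵐ[volume] u)
    (hU' : U' =ᵐ[volume] fun x => (-(Complex.I * ((ε⁻¹ : ℝ) : ℂ))) • sg pauli3 ((m x : ℂ) • u x)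
      - sg pauli1 ((∂_{((1, 0) : ℝ × ℝ)} u : 𝓢(ℝ × ℝ, EE)) x)
      - sg pauli2 ((∂_{((0, 1) : ℝ × ℝ)} u : 𝓢(ℝ × ℝ, EE)) x)) :
    |inner ℝ (U - Kop k U) (U' - Kop k U')| ≤
      (L' * (∫ z, ‖z‖ * ‖k z‖) / ε * ‖U‖) * ‖U - Kop k U‖ := by
  set u1 : 𝓢(ℝ × ℝ, EE) := ∂_{((1, 0) : ℝ × ℝ)} u with hu1
  set u2 : 𝓢(ℝ × ℝ, EE) := ∂_{((0, 1) : ℝ × ℝ)} u with hu2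
  set mu : ℝ × ℝ → EE := fun x => (m x : ℂ) • u x with hmu
  have hmuc : Continuous mu := (Complex.continuous_ofReal.comp hm).smul u.continuous
  obtain ⟨Bu, hBu⟩ := schwartz_bdd u
  have hmub : ∀ x, ‖mu x‖ ≤ B * Bu := fun x => by
    rw [hmu]
    simp only
    rw [norm_smul, Complex.norm_real, Real.norm_eq_abs]
    exact mul_le_mul (hB x) (hBu x) (norm_nonneg _) ((abs_nonneg _).trans (hB x))
  have imu : ∀ x, Integrable (fun z => k z • mu (x - z)) := int_ksmul k mu hmuc _ hmub
  have iu := int_ksmul' k u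
  have iu1 := int_ksmul' k u1
  have iu2 := int_ksmul' k u2
  set v : ℝ × ℝ → EE := fun x => u x - cv k u x with hv
  set v1 : ℝ × ℝ → EE := fun x => u1 x - cv k u1 x with hv1
  set v2 : ℝ × ℝ → EE := fun x => u2 x - cv k u2 x with hv2
  set w : ℝ × ℝ → EE := fun x => (Complex.I * ((ε⁻¹ : ℝ) : ℂ)) •
    sg pauli3 (cv k mu x - (m x : ℂ) • cv k u x) with hw
  have mem : ∀ f : 𝓢(ℝ × ℝ, EE), MemLp (fun x => f x - cv k f x) 2 volume := fun f =>
    (f.memLp 2).sub (cv_memLp k f f.continuous.stronglyMeasurable (f.memLp 2))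
  have mv : MemLp v 2 volume := mem u
  have mv1 : MemLp v1 2 volume := mem u1
  have mv2 : MemLp v2 2 volume := mem u2
  -- commutator bound
  have hwb : eLpNorm w 2 volume ≤ ENNReal.ofReal (L' / ε * ∫ z, ‖z‖ * ‖k z‖) * eLpNorm u 2 volume :=
    comm_bound m L' hL0 hL ε hε k u mu hmu imu w hw
  have hws : StronglyMeasurable w := by
    rw [hw]
    exact w_sm m hm (Complex.I * ((ε⁻¹ : ℝ) : ℂ)) k u mu u.continuous.stronglyMeasurable
      hmuc.stronglyMeasurable
  have hut : eLpNorm u 2 volume < ⊤ := (u.memLp 2 volume).2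
  have hwt : eLpNorm w 2 volume < ⊤ :=
    lt_of_le_of_lt hwb (ENNReal.mul_lt_top ENNReal.ofReal_lt_top hut)
  have mw : MemLp w 2 volume := ⟨hws.aestronglyMeasurable, hwt⟩
  have hV : (U - Kop k U : Lp EE 2 (volume : Measure (ℝ × ℝ))) =ᵐ[volume] v := by
    filter_upwards [Lp.coeFn_sub U (Kop k U), hU, Kop_ae k U u hU] with x a1 a2 a3
    rw [a1, Pi.sub_apply, a2, a3]
  have hV' : (U' - Kop k U' : Lp EE 2 (volume : Measure (ℝ × ℝ))) =ᵐ[volume] fun x =>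
      (Complex.I * ((-ε⁻¹ * m x : ℝ) : ℂ)) • sg pauli3 (v x) - sg pauli1 (v1 x) - sg pauli2 (v2 x)
        + w x := by
    filter_upwards [Lp.coeFn_sub U' (Kop k U'), hU', Kop_ae k U' _ hU'] with x a1 a2 a3
    rw [a1, Pi.sub_apply, a2, a3]
    have j1 : Integrable (fun z => k z • ((-(Complex.I * ((ε⁻¹ : ℝ) : ℂ))) • sg pauli3 (mu (x - z)))) := by
      have := ((-(Complex.I * ((ε⁻¹ : ℝ) : ℂ))) • sg pauli3).integrable_comp (imu x)
      simpa only [map_smul, _root_.smul_apply] using this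
    have j2 : Integrable (fun z => k z • sg pauli1 (u1 (x - z))) := by
      have := (sg pauli1).integrable_comp (iu1 x)
      simpa only [map_smul] using this
    have j3 : Integrable (fun z => k z • sg pauli2 (u2 (x - z))) := by
      have := (sg pauli2).integrable_comp (iu2 x)
      simpa only [map_smul] using this
    have e : cv k (fun x => (-(Complex.I * ((ε⁻¹ : ℝ) : ℂ))) • sg pauli3 ((m x : ℂ) • u x)
        - sg pauli1 (u1 x) - sg pauli2 (u2 x)) x =
        (-(Complex.I * ((ε⁻¹ : ℝ) : ℂ))) • sg pauli3 (cv k mu x) - sg pauli1 (cv k u1 x)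
          - sg pauli2 (cv k u2 x) := by
      rw [← cv_sg k (sg pauli1) u1 x (iu1 x), ← cv_sg k (sg pauli2) u2 x (iu2 x)]
      have := cv_sg k ((-(Complex.I * ((ε⁻¹ : ℝ) : ℂ))) • sg pauli3) mu x (imu x)
      simp only [_root_.smul_apply] at this
      have j12 : Integrable (fun z => k z • ((-(Complex.I * ((ε⁻¹ : ℝ) : ℂ))) • sg pauli3 (mu (x - z)))
          - k z • sg pauli1 (u1 (x - z))) := j1.sub j2
      rw [← this, ← integral_sub j1 j2, ← integral_sub j12 j3, cv]
      simp only [smul_sub, hmu]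
    rw [e]
    simp only [hv, hv1, hv2, hw, map_sub, map_smul]
    push_cast
    module
  have i1 := ibp (sg pauli1) sg1_symm v v1 mv mv1 (1, 0) (fun x => by
    have a := schwartz_lineDeriv u (1, 0) x
    have b := cv_lineDeriv k u (1, 0) x
    rw [HasLineDerivAt] at a b ⊢
    exact a.sub b)
  have i2 := ibp (sg pauli2) sg2_symm v v2 mv mv2 (0, 1) (fun x => by
    have a := schwartz_lineDeriv u (0, 1) x
    have b := cv_lineDeriv k u (0, 1) x
    rw [HasLineDerivAt] at a b ⊢
    exact a.sub b)
  have hW : inner ℝ (U - Kop k U) (U' - Kop k U') = inner ℝ (U - Kop k U) (mw.toLp w) := by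
    rw [L2.inner_def, L2.inner_def]
    have c1 : ∫ x, inner ℝ ((U - Kop k U : Lp EE 2 (volume : Measure (ℝ × ℝ))) x)
        ((U' - Kop k U' : Lp EE 2 (volume : Measure (ℝ × ℝ))) x) =
        ∫ x, (inner ℝ (v x) (w x) - inner ℝ (v x) (sg pauli1 (v1 x)) - inner ℝ (v x) (sg pauli2 (v2 x))) := by
      refine integral_congr_ae ?_
      filter_upwards [hV, hV'] with x a1 a2
      rw [a1, a2, inner_add_right, inner_sub_right, inner_sub_right, sg3_zero]
      ring
    have s1 : MemLp (fun x => sg pauli1 (v1 x)) 2 volume := (sg pauli1).comp_memLp' mv1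
    have s2 : MemLp (fun x => sg pauli2 (v2 x)) 2 volume := (sg pauli2).comp_memLp' mv2
    have s3 : Integrable (fun x => inner ℝ (v x) (w x) - inner ℝ (v x) (sg pauli1 (v1 x))) :=
      (int_inner mv mw).sub (int_inner mv s1)
    rw [c1, integral_sub s3 (int_inner mv s2),
      integral_sub (int_inner mv mw) (int_inner mv s1), i1, i2, sub_zero, sub_zero]
    refine integral_congr_ae ?_
    filter_upwards [hV, mw.coeFn_toLp] with x a1 a2
    rw [a1, a2]
  rw [hW]
  refine (abs_real_inner_le_norm _ _).trans ?_
  rw [mul_comm]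
  gcongr
  rw [Lp.norm_toLp, Lp.norm_def, eLpNorm_congr_ae hU]
  have h' := ENNReal.toReal_mono (ENNReal.mul_ne_top ENNReal.ofReal_ne_top hut.ne) hwb
  rw [ENNReal.toReal_mul, ENNReal.toReal_ofReal (mul_nonneg (by positivity)
    (integral_nonneg fun z => by positivity))] at h'
  refine h'.trans (le_of_eq ?_)
  ring

lemma core0 (m : ℝ × ℝ → ℝ) (hm : Continuous m) (B : ℝ) (hB : ∀ x, |m x| ≤ B) (L' : ℝ) (hL0 : 0 ≤ L')
    (hL : ∀ x z, |m (x - z) - m x| ≤ L' * ‖z‖) (ε : ℝ) (hε : 0 < ε)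
    (u : 𝓢(ℝ × ℝ, EE)) (U U' : Lp EE 2 (volume : Measure (ℝ × ℝ))) (hU : U =ᵐ[volume] u)
    (hU' : U' =ᵐ[volume] fun x => (-(Complex.I * ((ε⁻¹ : ℝ) : ℂ))) • sg pauli3 ((m x : ℂ) • u x)
      - sg pauli1 ((∂_{((1, 0) : ℝ × ℝ)} u : 𝓢(ℝ × ℝ, EE)) x)
      - sg pauli2 ((∂_{((0, 1) : ℝ × ℝ)} u : 𝓢(ℝ × ℝ, EE)) x)) :
    |inner ℝ U U'| ≤ 0 * ‖U‖ := by
  have h := core m hm B hB L' hL0 hL ε hε 0 u U U' hU hU'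
  have hK : ∀ W : Lp EE 2 (volume : Measure (ℝ × ℝ)), Kop 0 W = 0 := by
    intro W
    refine Lp.ext ?_
    filter_upwards [Kop_ae 0 W W Filter.EventuallyEq.rfl, Lp.coeFn_zero EE 2 (volume : Measure (ℝ × ℝ))] with x a b
    rw [a, b]
    simp [cv]
  simpa [hK] using h

lemma l2_eq (g : ℝ × ℝ → C2) (U : Lp EE 2 (volume : Measure (ℝ × ℝ)))
    (hU : U =ᵐ[volume] fun x => WithLp.toLp 2 (g x)) : l2normC2 g = ‖U‖ := by
  rw [l2normC2, ← Real.sqrt_sq (norm_nonneg U), ← real_inner_self_eq_norm_sq, L2.inner_def]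
  congr 1
  refine integral_congr_ae ?_
  filter_upwards [hU] with x hx
  rw [hx, real_inner_self_eq_norm_sq, EuclideanSpace.norm_sq_eq, Fin.sum_univ_two]

lemma lip_of_grad (m : ℝ × ℝ → ℝ) (hm : ContDiff ℝ (⊤ : ℕ∞) m) (L : ℝ)
    (hL : ∀ x, enorm2 (grad2 m x) ≤ L) (x z : ℝ × ℝ) : |m (x - z) - m x| ≤ 2 * |L| * ‖z‖ := by
  have hd : Differentiable ℝ m := hm.differentiable (by simp)
  have h := Convex.norm_image_sub_le_of_norm_fderiv_le (𝕜 := ℝ) (f := m) (s := Set.univ) (C := 2 * |L|)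
    (x := x) (y := x - z) (fun y _ => hd y) (fun y _ => ?_) convex_univ (Set.mem_univ _) (Set.mem_univ _)
  · have e : x - z - x = -z := by abel
    rwa [e, norm_neg, Real.norm_eq_abs] at h
  · refine ContinuousLinearMap.opNorm_le_bound _ (by positivity) fun p => ?_
    have hp : p = p.1 • ((1, 0) : ℝ × ℝ) + p.2 • ((0, 1) : ℝ × ℝ) := by
      ext <;> simp
    have g1 : |fderiv ℝ m y (1, 0)| ≤ |L| :=
      (Real.abs_le_sqrt (by simp only [grad2]; nlinarith [sq_nonneg (fderiv ℝ m y (0, 1))])).trans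
        ((hL y).trans (le_abs_self L))
    have g2 : |fderiv ℝ m y (0, 1)| ≤ |L| :=
      (Real.abs_le_sqrt (by simp only [grad2]; nlinarith [sq_nonneg (fderiv ℝ m y (1, 0))])).trans
        ((hL y).trans (le_abs_self L))
    have n1 : |p.1| ≤ ‖p‖ := norm_fst_le p
    have n2 : |p.2| ≤ ‖p‖ := norm_snd_le p
    calc ‖fderiv ℝ m y p‖ = |p.1 * fderiv ℝ m y (1, 0) + p.2 * fderiv ℝ m y (0, 1)| := by
          conv_lhs => rw [hp]
          rw [map_add, map_smul, map_smul, Real.norm_eq_abs, smul_eq_mul, smul_eq_mul]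
      _ ≤ |p.1| * |fderiv ℝ m y (1, 0)| + |p.2| * |fderiv ℝ m y (0, 1)| := by
          rw [← abs_mul, ← abs_mul]
          exact abs_add_le _ _
      _ ≤ ‖p‖ * |L| + ‖p‖ * |L| := by gcongr
      _ = _ := by ring

def toE : C2 →L[ℝ] EE :=
  ((EuclideanSpace.equiv (Fin 2) ℂ).symm : C2 →L[ℂ] EE).restrictScalars ℝ

lemma toE_apply (v : C2) : toE v = WithLp.toLp 2 v := rfl

lemma sg_toE (M : Matrix (Fin 2) (Fin 2) ℂ) (v : C2) : sg M (toE v) = toE (M.mulVec v) := by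
  rw [toE_apply, toE_apply, sg, Matrix.toEuclideanCLM_toLp]

lemma toE_csmul (c : ℂ) (v : C2) : toE (c • v) = c • toE v := rfl

def psiS {ε : ℝ} {m : ℝ × ℝ → ℝ} {ψ : ℝ → ℝ × ℝ → C2} (h : IsClassicalSolution ε m ψ) (t : ℝ) :
    𝓢(ℝ × ℝ, C2) where
  toFun := ψ t
  smooth' := h.smooth.comp (contDiff_const.prodMk contDiff_id)
  decay' := h.schwartz t

def phiS {ε : ℝ} {m : ℝ × ℝ → ℝ} {ψ : ℝ → ℝ × ℝ → C2} (h : IsClassicalSolution ε m ψ) (t : ℝ) :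
    𝓢(ℝ × ℝ, EE) := SchwartzMap.postcompCLM toE (psiS h t)

lemma phiS_apply {ε : ℝ} {m : ℝ × ℝ → ℝ} {ψ : ℝ → ℝ × ℝ → C2} (h : IsClassicalSolution ε m ψ) (t : ℝ)
    (x : ℝ × ℝ) : phiS h t x = toE (ψ t x) := rfl

lemma phiS_deriv {ε : ℝ} {m : ℝ × ℝ → ℝ} {ψ : ℝ → ℝ × ℝ → C2} (h : IsClassicalSolution ε m ψ) (t : ℝ)
    (x e : ℝ × ℝ) : (∂_{e} (phiS h t) : 𝓢(ℝ × ℝ, EE)) x = toE (fderiv ℝ (ψ t) x e) := by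
  rw [SchwartzMap.lineDerivOp_apply_eq_fderiv]
  have hd : HasFDerivAt (ψ t) (fderiv ℝ (ψ t) x) x := ((psiS h t).differentiableAt (x := x)).hasFDerivAt
  have := (toE.hasFDerivAt.comp x hd).fderiv
  have e2 : (phiS h t : ℝ × ℝ → EE) = toE ∘ ψ t := rfl
  rw [e2, this]
  rfl

lemma phiS_time {ε : ℝ} (hε : 0 < ε) {m : ℝ × ℝ → ℝ} {ψ : ℝ → ℝ × ℝ → C2}
    (h : IsClassicalSolution ε m ψ) (t : ℝ) (x : ℝ × ℝ) :
    HasDerivAt (fun τ => phiS h τ x) ((-(Complex.I * ((ε⁻¹ : ℝ) : ℂ))) • sg pauli3 ((m x : ℂ) • phiS h t x)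
      - sg pauli1 ((∂_{((1, 0) : ℝ × ℝ)} (phiS h t) : 𝓢(ℝ × ℝ, EE)) x)
      - sg pauli2 ((∂_{((0, 1) : ℝ × ℝ)} (phiS h t) : 𝓢(ℝ × ℝ, EE)) x)) t := by
  have hs : ContDiff ℝ (⊤ : ℕ∞) (fun τ => ψ τ x) := h.smooth.comp (contDiff_id.prodMk contDiff_const)
  have hd : HasDerivAt (fun τ => ψ τ x) (deriv (fun τ => ψ τ x) t) t :=
    (hs.differentiable (by simp) t).hasDerivAt
  have h2 := toE.hasFDerivAt.comp_hasDerivAt t hd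
  have heq := h.eqn t x
  have hεc : (ε : ℂ) ≠ 0 := by exact_mod_cast hε.ne'
  have e : deriv (fun τ => ψ τ x) t = (-(Complex.I * ((ε⁻¹ : ℝ) : ℂ))) • ((m x : ℂ) • pauli3.mulVec (ψ t x))
      - pauli1.mulVec (pdx (ψ t) x) - pauli2.mulVec (pdy (ψ t) x) := by
    have h3 : (-(Complex.I * ((ε⁻¹ : ℝ) : ℂ))) • ((Complex.I * (ε : ℂ)) • deriv (fun τ => ψ τ x) t) =
        deriv (fun τ => ψ τ x) t := by
      rw [smul_smul]
      have : -(Complex.I * ((ε⁻¹ : ℝ) : ℂ)) * (Complex.I * (ε : ℂ)) = 1 := by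
        push_cast
        field_simp
        simp
      rw [this, one_smul]
    have h4 : -(Complex.I * ((ε⁻¹ : ℝ) : ℂ)) * (Complex.I * (ε : ℂ)) = 1 := by
      push_cast
      field_simp
      simp
    rw [← h3, heq, diracOp, smul_sub, smul_sub, smul_smul _ (Complex.I * (ε : ℂ)),
      smul_smul _ (Complex.I * (ε : ℂ)), h4, one_smul, one_smul]
  rw [phiS_apply, phiS_deriv, phiS_deriv, ← toE_csmul, sg_toE, sg_toE, sg_toE, ← toE_csmul, ← map_sub,
    ← map_sub, Matrix.mulVec_smul]
  rw [e] at h2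
  exact h2

lemma fmult_eq {ε : ℝ} {m : ℝ × ℝ → ℝ} {ψ : ℝ → ℝ × ℝ → C2}
    (h : IsClassicalSolution ε m ψ) (t : ℝ) (b : ℝ × ℝ → ℂ) (k : 𝓢(ℝ × ℝ, ℂ))
    (hk : ∀ (g : 𝓢(ℝ × ℝ, ℂ)) x, ift2 (fun ξ => b ξ * ft2 g ξ) x = g x - ∫ z, k z * g (x - z))
    (x : ℝ × ℝ) : WithLp.toLp 2 (fmult b (ψ t) x) = phiS h t x - cv k (phiS h t) x := by
  ext i
  have h1 := hk (SchwartzMap.postcompCLM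
    (ContinuousLinearMap.proj (R := ℝ) (φ := fun _ : Fin 2 => ℂ) i) (psiS h t)) x
  have h2 := (EuclideanSpace.proj i : EE →L[ℂ] ℂ).integral_comp_comm
    (int_ksmul' k (phiS h t) x)
  change ift2 (fun ξ => b ξ * ft2 (fun z => ψ t z i) ξ) x = ψ t x i - (cv k (phiS h t) x) i
  have h3 : (cv k (phiS h t) x) i = ∫ z, k z * ψ t (x - z) i := h2.symm
  rw [h3]
  exact h1

lemma compLp_deriv (F : ℝ → Lp C2 2 (volume : Measure (ℝ × ℝ))) (hF : Differentiable ℝ F) (t : ℝ) :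
    HasDerivAt (fun τ => toE.compLpL 2 volume (F τ)) (toE.compLpL 2 volume (deriv F t)) t :=
  (toE.compLpL 2 volume).hasFDerivAt.comp_hasDerivAt t (hF t).hasDerivAt

/-- conservation of ε-oscillation. -/
theorem stmt5
    (χ : ℝ × ℝ → ℝ) (hχ : ContDiff ℝ (⊤ : ℕ∞) χ) (hχ01 : ∀ ξ, χ ξ ∈ Set.Icc (0:ℝ) 1)
    (hχ0 : ∀ ξ, enorm2 ξ < 1 → χ ξ = 0) (hχ1 : ∀ ξ, 2 < enorm2 ξ → χ ξ = 1)
    (L : ℝ) :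
    ∃ C > (0:ℝ), ∀ m : ℝ × ℝ → ℝ, ContDiff ℝ (⊤ : ℕ∞) m →
      (∀ n : ℕ, ∃ B : ℝ, ∀ x, ‖iteratedFDeriv ℝ n m x‖ ≤ B) →
      (∀ x, enorm2 (grad2 m x) ≤ L) →
      ∀ ε ∈ Set.Ioc (0:ℝ) 1, ∀ R ≥ (1:ℝ), ∀ ψ : ℝ → ℝ × ℝ → C2,
        IsClassicalSolution ε m ψ → ∀ t : ℝ,
        l2normC2 (fmult (fun ξ => ((χ ((ε / R) • ξ) : ℝ) : ℂ)) (ψ t))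
          ≤ l2normC2 (fmult (fun ξ => ((χ ((ε / R) • ξ) : ℝ) : ℂ)) (ψ 0))
            + C * |t| / R * l2normC2 (ψ 0) := by
  obtain ⟨c, hc, hfour⟩ := fourier_part χ hχ hχ1
  refine ⟨2 * |L| * c + 1, by positivity, fun m hm hmb hmL ε hε R hR ψ hψ t => ?_⟩
  have hε0 : 0 < ε := hε.1
  have hR0 : 0 < R := lt_of_lt_of_le one_pos hR
  obtain ⟨k, hkc, hk⟩ := hfour (ε / R) (div_pos hε0 hR0)
  obtain ⟨B, hB'⟩ := hmb 0
  have hB : ∀ x, |m x| ≤ B := fun x => by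
    have := hB' x
    rwa [norm_iteratedFDeriv_zero, Real.norm_eq_abs] at this
  have hLip := lip_of_grad m hm L hmL
  obtain ⟨F0, hF0d, hF0⟩ := hψ.l2diff
  obtain ⟨F, hF⟩ : ∃ F : ℝ → Lp EE 2 (volume : Measure (ℝ × ℝ)), F = fun τ => toE.compLpL 2 volume (F0 τ) :=
    ⟨_, rfl⟩
  obtain ⟨F', hF'⟩ : ∃ F' : ℝ → Lp EE 2 (volume : Measure (ℝ × ℝ)),
      F' = fun τ => toE.compLpL 2 volume (deriv F0 τ) := ⟨_, rfl⟩
  have hFd : ∀ s, HasDerivAt F (F' s) s := fun s => by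
    rw [hF, hF']
    exact compLp_deriv F0 hF0d s
  have hFae : ∀ s, F s =ᵐ[volume] phiS hψ s := fun s => by
    rw [hF]
    filter_upwards [toE.coeFn_compLpL (F0 s), hF0 s] with x a b
    rw [a, b, phiS_apply]
  have hF'ae := fun s => deriv_ae F (F' s) s (hFd s) (fun τ => phiS hψ τ) hFae _ (phiS_time hε0 hψ s)
  clear hF hF'
  have cons : ∀ s, ‖F s‖ ≤ ‖F 0‖ := fun s => by
    have := energy F F' 0 le_rfl hFd (fun r => core0 m hm.continuous B hB (2 * |L|) (by positivity)
      hLip ε hε0 (phiS hψ r) (F r) (F' r) (hFae r) (hF'ae r)) s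
    simpa using this
  have hGd : ∀ s, HasDerivAt (fun τ => F τ - Kop k (F τ)) (F' s - Kop k (F' s)) s := fun s =>
    (hFd s).sub (((Kop k).restrictScalars ℝ).hasFDerivAt.comp_hasDerivAt s (hFd s))
  have hmain := energy (fun τ => F τ - Kop k (F τ)) (fun s => F' s - Kop k (F' s))
    (2 * |L| * c / R * ‖F 0‖) (by positivity) hGd (fun s => by
      refine (core m hm.continuous B hB (2 * |L|) (by positivity)
        hLip ε hε0 k (phiS hψ s) (F s) (F' s) (hFae s) (hF'ae s)).trans ?_
      refine mul_le_mul_of_nonneg_right ?_ (norm_nonneg _)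
      rw [hkc]
      have e : 2 * |L| * (ε / R * c) / ε = 2 * |L| * c / R := by
        field_simp
      rw [e]
      exact mul_le_mul_of_nonneg_left (cons s) (by positivity)) t
  have hG : ∀ s, l2normC2 (fmult (fun ξ => ((χ ((ε / R) • ξ) : ℝ) : ℂ)) (ψ s)) = ‖F s - Kop k (F s)‖ :=
    fun s => by
      refine l2_eq _ _ ?_
      filter_upwards [Lp.coeFn_sub (F s) (Kop k (F s)), hFae s, Kop_ae k (F s) _ (hFae s)] with x a1 a2 a3
      rw [a1, Pi.sub_apply, a2, a3, fmult_eq hψ s _ k hk x]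
  have h0 : l2normC2 (ψ 0) = ‖F 0‖ := l2_eq _ _ (hFae 0)
  rw [hG, hG, h0]
  refine hmain.trans ?_
  have e : (2 * |L| * c + 1) * |t| / R * ‖F 0‖ = 2 * |L| * c / R * ‖F 0‖ * |t| + |t| / R * ‖F 0‖ := by
    ring
  rw [e]
  have : 0 ≤ |t| / R * ‖F 0‖ := by positivity
  linarith
end
end

section
/- Let m ∈ C^∞(ℝ²,ℝ) have all derivatives bounded, and let χ ∈ C^∞(ℝ²,[0,1]) satisfy χ(x) = 0 for |x| < 1 and χ(x) = 1 for |x| > 2, with bounded gradient. Then there exists a constant C > 0, depending only on χ, such that for every ε ∈ (0,1], every R ≥ 1, every classical solution ψ of the Dirac equation with parameter ε, and every t ∈ ℝ: ‖χ(·/R) ψ(t,·)‖_{L²(ℝ²,ℂ²)} ≤ ‖χ(·/R) ψ(0,·)‖_{L²(ℝ²,ℂ²)} + (C|t|/R) ‖ψ(0,·)‖_{L²(ℝ²,ℂ²)}, where χ(·/R) acts by pointwise multiplication. (Conservation of compactness at infinity.) -/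
open MeasureTheory Complex

noncomputable section

lemma ode_bound (E E' f : ℝ → ℝ) (a : ℝ) (ha : 0 ≤ a) (hf : ∀ t, 0 ≤ f t) (hE : ∀ t, E t = f t ^ 2)
    (hd : ∀ t, HasDerivAt E (E' t) t) (hb : ∀ t, |E' t| ≤ 2 * a * f t) (t : ℝ) :
    f t ≤ f 0 + a * |t| := by
  refine le_of_forall_pos_le_add fun δ hδ => ?_
  have hpos : ∀ s, 0 < E s + δ ^ 2 := fun s => by rw [hE]; positivity
  have hg : ∀ s, HasDerivAt (fun s => Real.sqrt (E s + δ ^ 2))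
      (E' s / (2 * Real.sqrt (E s + δ ^ 2))) s := fun s =>
    ((hd s).add_const (δ ^ 2)).sqrt (hpos s).ne'
  have hfg : ∀ s, f s ≤ Real.sqrt (E s + δ ^ 2) := fun s => by
    apply Real.le_sqrt_of_sq_le; rw [hE]; nlinarith
  have hgd : ∀ s, f s + δ ≥ Real.sqrt (E s + δ ^ 2) := fun s => by
    apply Real.sqrt_le_iff.2 ⟨by linarith [hf s], ?_⟩; rw [hE]; nlinarith [hf s]
  have key := Convex.norm_image_sub_le_of_norm_hasDerivWithin_le (C := |a|)
    (fun s (_ : s ∈ Set.univ) => (hg s).hasDerivWithinAt) (fun s _ => ?_) convex_univ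
    (Set.mem_univ 0) (Set.mem_univ t)
  · rw [abs_of_nonneg ha, Real.norm_eq_abs, Real.norm_eq_abs, sub_zero] at key
    linarith [le_abs_self (Real.sqrt (E t + δ ^ 2) - Real.sqrt (E 0 + δ ^ 2)), hfg t, hgd 0]
  · have hs : 0 < Real.sqrt (E s + δ ^ 2) := Real.sqrt_pos.2 (hpos s)
    rw [Real.norm_eq_abs, abs_div, abs_of_pos (by positivity : 0 < 2 * Real.sqrt (E s + δ ^ 2)),
      div_le_iff₀ (by positivity)]
    have := hb s
    have := hfg s
    have := le_abs_self a
    have := hf s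
    have h1 : a * f s ≤ |a| * f s := by gcongr
    have h2 : |a| * f s ≤ |a| * Real.sqrt (E s + δ ^ 2) := by gcongr
    linarith

lemma ibp_sq (w f g : ℝ × ℝ → ℝ) (v : ℝ × ℝ) (b : ℝ)
    (hw : ContDiff ℝ (⊤ : ℕ∞) w) (hw1 : ∀ x, |w x| ≤ 1) (hwv : ∀ x, |fderiv ℝ w x v| ≤ b)
    (hf : Differentiable ℝ f) (hg : Differentiable ℝ g)
    (hf2 : MemLp f 2 volume) (hg2 : MemLp g 2 volume)
    (hfv : MemLp (fun x => fderiv ℝ f x v) 2 volume)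
    (hgv : MemLp (fun x => fderiv ℝ g x v) 2 volume) :
    Integrable (fun x => w x ^ 2 * (fderiv ℝ f x v * g x + f x * fderiv ℝ g x v)) ∧
    Integrable (fun x => 2 * w x * fderiv ℝ w x v * (f x * g x)) ∧
    ∫ x, w x ^ 2 * (fderiv ℝ f x v * g x + f x * fderiv ℝ g x v)
      = - ∫ x, 2 * w x * fderiv ℝ w x v * (f x * g x) := by
  have hwd : Differentiable ℝ w := hw.differentiable (by simp)
  have hwc : Continuous w := hw.continuous
  have hwvc : Continuous (fun x => fderiv ℝ w x v) :=
    (hw.continuous_fderiv (by simp)).clm_apply continuous_const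
  have hfg : Integrable (fun x => f x * g x) := hf2.integrable_mul hg2
  have hfg' : Integrable (fun x => fderiv ℝ f x v * g x + f x * fderiv ℝ g x v) :=
    (hfv.integrable_mul hg2).add (hf2.integrable_mul hgv)
  have hsq : ∀ x, ‖w x ^ 2‖ ≤ 1 := fun x => by
    rw [norm_pow]; exact pow_le_one₀ (norm_nonneg _) (hw1 x)
  have e1 : ∀ x, fderiv ℝ (fun x => w x ^ 2) x v = 2 * w x * fderiv ℝ w x v := fun x => by
    have := ((hwd x).hasFDerivAt.pow 2).fderiv
    rw [this]; simp
  have e2 : ∀ x, fderiv ℝ (fun x => f x * g x) x v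
      = fderiv ℝ f x v * g x + f x * fderiv ℝ g x v := fun x => by
    have := ((hf x).hasFDerivAt.mul (hg x).hasFDerivAt).fderiv
    erw [this]; simp; ring
  have i1 : Integrable (fun x => w x ^ 2 * (fderiv ℝ f x v * g x + f x * fderiv ℝ g x v)) :=
    hfg'.bdd_mul (hwc.pow 2).aestronglyMeasurable (ae_of_all _ hsq)
  have i2 : Integrable (fun x => 2 * w x * fderiv ℝ w x v * (f x * g x)) := by
    refine hfg.bdd_mul (c := 2 * b)
      ((continuous_const.mul hwc).mul hwvc).aestronglyMeasurable (ae_of_all _ fun x => ?_)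
    rw [norm_mul, norm_mul, Real.norm_eq_abs, Real.norm_eq_abs, Real.norm_eq_abs, abs_two]
    have := hw1 x
    have := hwv x
    have := abs_nonneg (w x)
    have := abs_nonneg (fderiv ℝ w x v)
    nlinarith
  have i3 : Integrable (fun x => w x ^ 2 * (f x * g x)) :=
    hfg.bdd_mul (hwc.pow 2).aestronglyMeasurable (ae_of_all _ hsq)
  refine ⟨i1, i2, ?_⟩
  have := integral_mul_fderiv_eq_neg_fderiv_mul_of_integrable (μ := (volume : Measure (ℝ × ℝ)))
    (f := fun x => w x ^ 2) (g := fun x => f x * g x) (v := v)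
    (by simpa only [e1] using i2) (by simpa only [e2] using i1) i3
    (fun x _ => (hwd x).pow 2) (fun x _ => (hf x).mul (hg x))
  simpa only [e1, e2] using this

/-- The real-linear identification of `ℂ²` with `ℝ⁴`. -/
def toR4 : C2 →L[ℝ] EuclideanSpace ℝ (Fin 4) :=
  LinearMap.toContinuousLinearMap
    { toFun := fun v => !₂[(v 0).re, (v 0).im, (v 1).re, (v 1).im]
      map_add' := fun v w => by ext i; fin_cases i <;> simp
      map_smul' := fun c w => by ext i; fin_cases i <;> simp }

lemma toR4_apply (v : C2) : toR4 v = !₂[(v 0).re, (v 0).im, (v 1).re, (v 1).im] := rfl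

lemma toR4_inner (v v' : C2) : inner ℝ (toR4 v) (toR4 v')
    = (v 0).re * (v' 0).re + (v 0).im * (v' 0).im + (v 1).re * (v' 1).re
      + (v 1).im * (v' 1).im := by
  simp [toR4_apply, PiLp.inner_apply, Fin.sum_univ_four]
  ring

lemma deriv_Lp (F : ℝ → Lp C2 2 (volume : Measure (ℝ × ℝ))) (hF : Differentiable ℝ F)
    (ψ ψt : ℝ → ℝ × ℝ → C2) (h : ∀ t, (F t : ℝ × ℝ → C2) =ᵐ[volume] ψ t)
    (hψ : ∀ t x, HasDerivAt (fun τ => ψ τ x) (ψt t x) t) (t : ℝ) :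
    (deriv F t : Lp C2 2 (volume : Measure (ℝ × ℝ))) =ᵐ[volume] ψt t := by
  let hn : ℕ → ℝ := fun n => 1 / ((n : ℝ) + 1)
  have hn0 : Filter.Tendsto hn Filter.atTop (nhdsWithin 0 {0}ᶜ) := by
    refine tendsto_nhdsWithin_iff.2 ⟨tendsto_one_div_add_atTop_nhds_zero_nat, ?_⟩
    refine Filter.Eventually.of_forall fun n => ?_
    simp only [hn, Set.mem_compl_iff, Set.mem_singleton_iff]
    positivity
  have h1 : Filter.Tendsto (fun n => (hn n)⁻¹ • (F (t + hn n) - F t)) Filter.atTop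
      (nhds (deriv F t)) :=
    ((hF t).hasDerivAt.tendsto_slope_zero).comp hn0
  obtain ⟨φ, hφ, hae⟩ := (tendstoInMeasure_of_tendsto_Lp h1).exists_seq_tendsto_ae
  have hall : ∀ᵐ x ∂(volume : Measure (ℝ × ℝ)), ∀ n,
      ((hn n)⁻¹ • (F (t + hn n) - F t) : Lp C2 2 (volume : Measure (ℝ × ℝ))) x
        = (hn n)⁻¹ • (ψ (t + hn n) x - ψ t x) := by
    rw [ae_all_iff]
    intro n
    filter_upwards [h t, h (t + hn n), Lp.coeFn_smul (hn n)⁻¹ (F (t + hn n) - F t),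
      Lp.coeFn_sub (F (t + hn n)) (F t)] with x a1 a2 a3 a4
    rw [a3, Pi.smul_apply, a4, Pi.sub_apply, a1, a2]
  filter_upwards [hae, hall] with x hx hx2
  refine tendsto_nhds_unique hx ?_
  simp only [hx2]
  exact ((hψ t x).tendsto_slope_zero.comp hn0).comp hφ.tendsto_atTop

lemma static_bound (ε : ℝ) (hε : 0 < ε) (m : ℝ × ℝ → ℝ) (u ut : ℝ × ℝ → C2)
    (hu : ContDiff ℝ (⊤ : ℕ∞) u)
    (hdec : ∀ k n : ℕ, ∃ C : ℝ, ∀ x : ℝ × ℝ, ‖x‖ ^ k * ‖iteratedFDeriv ℝ n u x‖ ≤ C)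
    (heq : ∀ x, (Complex.I * (ε : ℂ)) • ut x = diracOp ε m u x)
    (w : ℝ × ℝ → ℝ) (b : ℝ) (hw : ContDiff ℝ (⊤ : ℕ∞) w)
    (hw0 : ∀ x, 0 ≤ w x) (hw1 : ∀ x, w x ≤ 1)
    (hwb : ∀ x, ‖fderiv ℝ w x‖ ≤ b) :
    |∫ x, w x ^ 2 * inner ℝ (toR4 (u x)) (toR4 (ut x))|
      ≤ 2 * b * ∫ x, w x * inner ℝ (toR4 (u x)) (toR4 (u x)) := by
  let U : SchwartzMap (ℝ × ℝ) C2 := ⟨u, hu, hdec⟩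
  have hud : Differentiable ℝ u := hu.differentiable (by simp)
  have hU : MemLp u 2 volume := U.memLp 2
  have hdU : ∀ v, MemLp (fun x => fderiv ℝ u x v) 2 volume := fun v => by
    have h := (SchwartzMap.fderivCLM ℝ (ℝ × ℝ) C2 U).memLp 2 (volume : Measure (ℝ × ℝ))
    exact (ContinuousLinearMap.apply ℝ C2 v).comp_memLp' h
  have hw1' : ∀ x, |w x| ≤ 1 := fun x => by rw [abs_of_nonneg (hw0 x)]; exact hw1 x
  have hwv : ∀ v : ℝ × ℝ, ‖v‖ ≤ 1 → ∀ x, |fderiv ℝ w x v| ≤ b := fun v hv x => by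
    have := (fderiv ℝ w x).le_opNorm v
    have h2 := hwb x
    have := norm_nonneg (fderiv ℝ w x)
    rw [Real.norm_eq_abs] at *
    nlinarith [norm_nonneg v]
  have hb : 0 ≤ b := (norm_nonneg _).trans (hwb 0)
  have comp : ∀ ℓ : C2 →L[ℝ] ℝ, Differentiable ℝ (fun x => ℓ (u x)) ∧
      MemLp (fun x => ℓ (u x)) 2 volume ∧
      (∀ x v, fderiv ℝ (fun x => ℓ (u x)) x v = ℓ (fderiv ℝ u x v)) ∧
      (∀ v, MemLp (fun x => fderiv ℝ (fun x => ℓ (u x)) x v) 2 volume) := fun ℓ => by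
    have h3 : ∀ x v, fderiv ℝ (fun x => ℓ (u x)) x v = ℓ (fderiv ℝ u x v) := fun x v => by
      have := (ℓ.hasFDerivAt.comp x (hud x).hasFDerivAt).fderiv
      erw [this]; rfl
    refine ⟨ℓ.differentiable.comp hud, ℓ.comp_memLp' hU, h3, fun v => ?_⟩
    simp only [h3]
    exact ℓ.comp_memLp' (hdU v)
  let pr : Fin 2 → (C2 →L[ℝ] ℂ) := fun i => ContinuousLinearMap.proj i
  obtain ⟨a1, a2, a3, a4⟩ := comp (Complex.reCLM ∘L pr 0)
  obtain ⟨b1, b2, b3, b4⟩ := comp (Complex.imCLM ∘L pr 0)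
  obtain ⟨c1, c2, c3, c4⟩ := comp (Complex.reCLM ∘L pr 1)
  obtain ⟨d1, d2, d3, d4⟩ := comp (Complex.imCLM ∘L pr 1)
  have nx : ‖((1, 0) : ℝ × ℝ)‖ ≤ 1 := by simp [Prod.norm_def]
  have ny : ‖((0, 1) : ℝ × ℝ)‖ ≤ 1 := by simp [Prod.norm_def]
  obtain ⟨p1, q1, r1⟩ := ibp_sq w _ _ (1, 0) b hw hw1' (hwv _ nx) a1 c1 a2 c2 (a4 _) (c4 _)
  obtain ⟨p2, q2, r2⟩ := ibp_sq w _ _ (1, 0) b hw hw1' (hwv _ nx) b1 d1 b2 d2 (b4 _) (d4 _)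
  obtain ⟨p3, q3, r3⟩ := ibp_sq w _ _ (0, 1) b hw hw1' (hwv _ ny) a1 d1 a2 d2 (a4 _) (d4 _)
  obtain ⟨p4, q4, r4⟩ := ibp_sq w _ _ (0, 1) b hw hw1' (hwv _ ny) b1 c1 b2 c2 (b4 _) (c4 _)
  have hval : ∀ x, w x ^ 2 * inner ℝ (toR4 (u x)) (toR4 (ut x)) =
      - (w x ^ 2 * ((fderiv ℝ u x (1,0) 0).re * (u x 1).re + (u x 0).re * (fderiv ℝ u x (1,0) 1).re))
      - (w x ^ 2 * ((fderiv ℝ u x (1,0) 0).im * (u x 1).im + (u x 0).im * (fderiv ℝ u x (1,0) 1).im))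
      - (w x ^ 2 * ((fderiv ℝ u x (0,1) 0).re * (u x 1).im + (u x 0).re * (fderiv ℝ u x (0,1) 1).im))
      + (w x ^ 2 * ((fderiv ℝ u x (0,1) 0).im * (u x 1).re + (u x 0).im * (fderiv ℝ u x (0,1) 1).re))
      := fun x => by
    have e0 := congrFun (heq x) 0
    have e1 := congrFun (heq x) 1
    simp only [diracOp, pauli1, pauli2, pauli3, pdx, pdy, Matrix.mulVec, dotProduct,
      Fin.sum_univ_two, Pi.smul_apply, Pi.sub_apply, smul_eq_mul] at e0 e1
    have e0r := congrArg Complex.re e0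
    have e0i := congrArg Complex.im e0
    have e1r := congrArg Complex.re e1
    have e1i := congrArg Complex.im e1
    simp at e0r e0i e1r e1i
    rw [toR4_inner]
    have hne := hε.ne'
    apply mul_left_cancel₀ hne
    linear_combination (w x ^ 2) * ((u x 0).re * e0i - (u x 0).im * e0r
      + (u x 1).re * e1i - (u x 1).im * e1r)
  simp only [a3, b3, c3, d3] at p1 p2 p3 p4 r1 r2 r3 r4
  simp only [ContinuousLinearMap.comp_apply, pr, ContinuousLinearMap.proj_apply,
    Complex.reCLM_apply, Complex.imCLM_apply] at p1 p2 p3 p4 q1 q2 q3 q4 r1 r2 r3 r4 a2 b2 c2 d2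
  simp only [hval]
  rw [integral_add (by exact (p1.neg.sub p2).sub p3) p4, integral_sub (by exact p1.neg.sub p2) p3,
    integral_sub (by exact p1.neg) p2, integral_neg, r1, r2, r3, r4]
  simp only [neg_neg, sub_neg_eq_add]
  rw [← integral_add q1 q2, ← integral_add (by exact q1.add q2) q3, ← sub_eq_add_neg,
    ← integral_sub (by exact (q1.add q2).add q3) q4, ← integral_const_mul, ← Real.norm_eq_abs]
  refine norm_integral_le_of_norm_le ?_ (ae_of_all _ fun x => ?_)
  · refine Integrable.const_mul ?_ _
    simp only [toR4_inner]
    refine Integrable.bdd_mul (c := 1) ?_ hw.continuous.aestronglyMeasurable (ae_of_all _ hw1')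
    exact (((a2.integrable_mul a2).add (b2.integrable_mul b2)).add
      (c2.integrable_mul c2)).add (d2.integrable_mul d2)
  · rw [toR4_inner, Real.norm_eq_abs]
    have h1 := hwv _ nx x
    have h2 := hwv _ ny x
    have h0 := hw0 x
    generalize (u x 0).re = a
    generalize (u x 0).im = b'
    generalize (u x 1).re = c
    generalize (u x 1).im = d
    generalize fderiv ℝ w x (1, 0) = P at *
    generalize fderiv ℝ w x (0, 1) = Q at *
    have e : 2 * w x * P * (a * c) + 2 * w x * P * (b' * d) + 2 * w x * Q * (a * d)
        - 2 * w x * Q * (b' * c) = 2 * w x * (P * (a * c + b' * d) + Q * (a * d - b' * c)) := by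
      ring
    rw [e, abs_mul, abs_of_nonneg (by positivity : 0 ≤ 2 * w x)]
    have k1 : |P * (a * c + b' * d)| ≤ b * ((a ^ 2 + b' ^ 2 + c ^ 2 + d ^ 2) / 2) := by
      rw [abs_mul]
      refine mul_le_mul h1 (abs_le.2 ⟨?_, ?_⟩) (abs_nonneg _) hb
      · nlinarith [sq_nonneg (a + c), sq_nonneg (b' + d)]
      · nlinarith [sq_nonneg (a - c), sq_nonneg (b' - d)]
    have k2 : |Q * (a * d - b' * c)| ≤ b * ((a ^ 2 + b' ^ 2 + c ^ 2 + d ^ 2) / 2) := by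
      rw [abs_mul]
      refine mul_le_mul h2 (abs_le.2 ⟨?_, ?_⟩) (abs_nonneg _) hb
      · nlinarith [sq_nonneg (a + d), sq_nonneg (b' - c)]
      · nlinarith [sq_nonneg (a - d), sq_nonneg (b' + c)]
    have k3 := abs_add_le (P * (a * c + b' * d)) (Q * (a * d - b' * c))
    calc 2 * w x * |P * (a * c + b' * d) + Q * (a * d - b' * c)|
        ≤ 2 * w x * (b * (a ^ 2 + b' ^ 2 + c ^ 2 + d ^ 2)) := by
          gcongr; linarith
      _ = _ := by ring

lemma energy_s6 (ε : ℝ) (hε : 0 < ε) (m : ℝ × ℝ → ℝ) (ψ : ℝ → ℝ × ℝ → C2)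
    (hψ : IsClassicalSolution ε m ψ) (w : ℝ × ℝ → ℝ) (b N : ℝ) (hw : ContDiff ℝ (⊤ : ℕ∞) w)
    (hw0 : ∀ x, 0 ≤ w x) (hw1 : ∀ x, w x ≤ 1) (hb : 0 ≤ b) (hN : 0 ≤ N)
    (hwb : ∀ x, ‖fderiv ℝ w x‖ ≤ b)
    (hbN : ∀ s, b * l2normC2 (ψ s) ≤ b * N) (t : ℝ) :
    l2normC2 (fun x => ((w x : ℝ) : ℂ) • ψ t x)
      ≤ l2normC2 (fun x => ((w x : ℝ) : ℂ) • ψ 0 x) + 2 * b * N * |t| := by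
  obtain ⟨F, hF, hFψ⟩ := hψ.l2diff
  have hder : ∀ t x, HasDerivAt (fun τ => ψ τ x) (deriv (fun τ => ψ τ x) t) t := fun t x => by
    apply DifferentiableAt.hasDerivAt
    have h1 : Differentiable ℝ (fun p : ℝ × (ℝ × ℝ) => ψ p.1 p.2) :=
      hψ.smooth.differentiable (by simp)
    exact (h1.comp (differentiable_id.prodMk (differentiable_const x))) t
  have hsm : ∀ t, ContDiff ℝ (⊤ : ℕ∞) (ψ t) := fun t =>
    hψ.smooth.comp (contDiff_const.prodMk contDiff_id)
  have hF' := deriv_Lp F hF ψ _ hFψ hder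
  have hwm : MemLp w ⊤ (volume : Measure (ℝ × ℝ)) :=
    memLp_top_of_bound hw.continuous.aestronglyMeasurable 1 (ae_of_all _ fun x => by
      rw [Real.norm_eq_abs, abs_of_nonneg (hw0 x)]; exact hw1 x)
  let T : Lp C2 2 (volume : Measure (ℝ × ℝ)) →L[ℝ]
      Lp (EuclideanSpace ℝ (Fin 4)) 2 (volume : Measure (ℝ × ℝ)) := toR4.compLpL 2 volume
  let Wm : Lp (EuclideanSpace ℝ (Fin 4)) 2 (volume : Measure (ℝ × ℝ)) →L[ℝ]
      Lp (EuclideanSpace ℝ (Fin 4)) 2 (volume : Measure (ℝ × ℝ)) :=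
    (ContinuousLinearMap.lsmul ℝ ℝ).holderL volume ⊤ 2 2 hwm.toLp
  have hT : ∀ (f : Lp C2 2 (volume : Measure (ℝ × ℝ))) (g : ℝ × ℝ → C2), f =ᵐ[volume] g →
      T f =ᵐ[volume] fun x => toR4 (g x) := fun f g hfg => by
    filter_upwards [toR4.coeFn_compLpL f, hfg] with x h1 h2
    rw [h1, h2]
  have hW : ∀ (f : Lp C2 2 (volume : Measure (ℝ × ℝ))) (g : ℝ × ℝ → C2), f =ᵐ[volume] g →
      Wm (T f) =ᵐ[volume] fun x => w x • toR4 (g x) := fun f g hfg => by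
    filter_upwards [(ContinuousLinearMap.lsmul ℝ ℝ).coeFn_holder (r := 2) hwm.toLp (T f),
      hT f g hfg, hwm.coeFn_toLp] with x h1 h2 h3
    have : (Wm (T f)) x = _ := h1
    rw [this, h2, h3]; rfl
  have hn1 : ∀ s, ‖T (F s)‖ = l2normC2 (ψ s) := fun s => by
    rw [l2normC2, norm_eq_sqrt_real_inner, L2.inner_def]
    congr 1
    refine integral_congr_ae ?_
    filter_upwards [hT _ _ (hFψ s)] with x hx
    rw [hx, toR4_inner, Complex.sq_norm, Complex.sq_norm, Complex.normSq_apply,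
      Complex.normSq_apply]
    ring
  have hn2 : ∀ s, ‖Wm (T (F s))‖ = l2normC2 (fun x => ((w x : ℝ) : ℂ) • ψ s x) := fun s => by
    rw [l2normC2, norm_eq_sqrt_real_inner, L2.inner_def]
    congr 1
    refine integral_congr_ae ?_
    filter_upwards [hW _ _ (hFψ s)] with x hx
    rw [hx, real_inner_smul_left, real_inner_smul_right, toR4_inner, Complex.sq_norm,
      Complex.sq_norm, Complex.normSq_apply, Complex.normSq_apply]
    simp
    ring
  have hd : ∀ s, HasDerivAt (fun s => ‖Wm (T (F s))‖ ^ 2)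
      (2 * inner ℝ (Wm (T (F s))) (Wm (T (deriv F s)))) s := fun s => by
    have h1 : HasDerivAt (fun s => Wm (T (F s))) (Wm (T (deriv F s))) s :=
      (Wm ∘L T).hasFDerivAt.comp_hasDerivAt s (hF s).hasDerivAt
    exact h1.norm_sq
  have := ode_bound (fun s => ‖Wm (T (F s))‖ ^ 2) _ (fun s => ‖Wm (T (F s))‖) (2 * b * N)
    (by positivity) (fun s => norm_nonneg _) (fun s => rfl) hd (fun s => ?_) t
  · simpa only [hn2] using this
  · have i1 : inner ℝ (Wm (T (F s))) (Wm (T (deriv F s)))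
        = ∫ x, w x ^ 2 * inner ℝ (toR4 (ψ s x)) (toR4 (deriv (fun τ => ψ τ x) s)) := by
      rw [L2.inner_def]
      refine integral_congr_ae ?_
      filter_upwards [hW _ _ (hFψ s), hW _ _ (hF' s)] with x h1 h2
      rw [h1, h2, real_inner_smul_left, real_inner_smul_right]
      ring
    have i2 : inner ℝ (Wm (T (F s))) (T (F s))
        = ∫ x, w x * inner ℝ (toR4 (ψ s x)) (toR4 (ψ s x)) := by
      rw [L2.inner_def]
      refine integral_congr_ae ?_
      filter_upwards [hW _ _ (hFψ s), hT _ _ (hFψ s)] with x h1 h2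
      rw [h1, h2, real_inner_smul_left]
    have sb := static_bound ε hε m (ψ s) _ (hsm s) (hψ.schwartz s) (hψ.eqn s) w b hw hw0 hw1 hwb
    rw [← i1, ← i2] at sb
    have cs := real_inner_le_norm (Wm (T (F s))) (T (F s))
    rw [hn1] at cs
    rw [abs_mul, abs_two]
    have h3 : b * inner ℝ (Wm (T (F s))) (T (F s)) ≤ b * (‖Wm (T (F s))‖ * l2normC2 (ψ s)) := by
      gcongr
    have h4 : ‖Wm (T (F s))‖ * (b * l2normC2 (ψ s)) ≤ ‖Wm (T (F s))‖ * (b * N) := by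
      gcongr ?_ * ?_
      exact hbN s
    nlinarith

/-- conservation of compactness at infinity. -/
theorem stmt6
    (χ : ℝ × ℝ → ℝ) (hχ : ContDiff ℝ (⊤ : ℕ∞) χ) (hχ01 : ∀ x, χ x ∈ Set.Icc (0:ℝ) 1)
    (hχ0 : ∀ x, enorm2 x < 1 → χ x = 0) (hχ1 : ∀ x, 2 < enorm2 x → χ x = 1)
    (hχgrad : ∃ B : ℝ, ∀ x, ‖fderiv ℝ χ x‖ ≤ B) :
    ∃ C > (0:ℝ), ∀ m : ℝ × ℝ → ℝ, ContDiff ℝ (⊤ : ℕ∞) m →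
      (∀ n : ℕ, ∃ B : ℝ, ∀ x, ‖iteratedFDeriv ℝ n m x‖ ≤ B) →
      ∀ ε ∈ Set.Ioc (0:ℝ) 1, ∀ R ≥ (1:ℝ), ∀ ψ : ℝ → ℝ × ℝ → C2,
        IsClassicalSolution ε m ψ → ∀ t : ℝ,
        l2normC2 (fun x => ((χ (R⁻¹ • x) : ℝ) : ℂ) • ψ t x)
          ≤ l2normC2 (fun x => ((χ (R⁻¹ • x) : ℝ) : ℂ) • ψ 0 x)
            + C * |t| / R * l2normC2 (ψ 0) := by
  obtain ⟨B, hB⟩ := hχgrad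
  have hB0 : 0 ≤ B := (norm_nonneg _).trans (hB 0)
  refine ⟨2 * B + 1, by positivity, ?_⟩
  intro m _ _ ε hε R hR ψ hψ t
  have hR0 : 0 < R := by linarith
  have hN : 0 ≤ l2normC2 (ψ 0) := Real.sqrt_nonneg _
  have cons : ∀ s, l2normC2 (ψ s) ≤ l2normC2 (ψ 0) := fun s => by
    have := energy_s6 ε hε.1 m ψ hψ (fun _ => 1) 0 0 contDiff_const (by simp) (by simp)
      le_rfl le_rfl (by simp) (by simp) s
    simpa using this
  have hχd : Differentiable ℝ χ := hχ.differentiable (by simp)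
  have hwb : ∀ x, ‖fderiv ℝ (fun x => χ (R⁻¹ • x)) x‖ ≤ B / R := fun x => by
    rw [fderiv_comp_smul, norm_smul, Real.norm_eq_abs, abs_of_pos (inv_pos.2 hR0),
      div_eq_inv_mul]
    gcongr
    exact hB _
  have key := energy_s6 ε hε.1 m ψ hψ (fun x => χ (R⁻¹ • x)) (B / R) (l2normC2 (ψ 0))
    (hχ.comp (contDiff_const_smul R⁻¹)) (fun x => (hχ01 _).1) (fun x => (hχ01 _).2)
    (by positivity) hN hwb (fun s => by gcongr; exact cons s) t
  refine key.trans (add_le_add le_rfl ?_)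
  have : 2 * (B / R) * l2normC2 (ψ 0) * |t| = (2 * B) * |t| / R * l2normC2 (ψ 0) := by ring
  rw [this]
  gcongr
  linarith
end
end
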